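/- arXiv:1709.07329 — 2 statements merged into one kernel-verified Lean document; each statement's English description precedes it below -/
import Mathlib

section
/- Let U be an open connected set in ℝ^l and x ↦ ξ(x) an analytic map from U to L¹(P; ℝ^d). Then there exists a family of processes (M_t(x))_{t≥0}, x ∈ U, such that: (i) for every x ∈ U and t ≥ 0, M_t(x) = E_P[ξ(x) | F_t] P-almost surely; (ii) for every ω ∈ Ω and x ∈ U, the path t ↦ M_t(x)(ω) is right-continuous with left limits and bounded on [0,∞); and (iii) for every ω ∈ Ω, the map x ↦ (t ↦ M_t(x)(ω)), viewed as a map from U into the Banach space of bounded ℝ^d-valued functions on [0,∞) equipped with the supremum norm, is analytic on U. -/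
open MeasureTheory Filter Set
open scoped ENNReal NNReal

noncomputable section


/-- Dyadic grid. -/
def dyGrid (n k : ℕ) : ℝ≥0 := (k : ℝ≥0) / 2 ^ n

/-- Dyadic points of level `n`. -/
def dyLevel (n : ℕ) : Set ℝ≥0 := range (dyGrid n)

/-- All dyadic points. -/
def dyAll : Set ℝ≥0 := ⋃ n, dyLevel n

lemma dyGrid_strictMono (n : ℕ) : StrictMono (dyGrid n) := by
  intro a b h
  unfold dyGrid
  have : (a : ℝ≥0) < b := by exact_mod_cast h
  gcongr

lemma dyLevel_mono : Monotone dyLevel := by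
  refine monotone_nat_of_le_succ fun n => ?_
  rintro _ ⟨k, rfl⟩
  refine ⟨2 * k, ?_⟩
  simp only [dyGrid]
  push_cast
  rw [pow_succ, mul_comm (2 ^ n) 2, mul_div_mul_left _ _ two_ne_zero]

lemma dyAll_countable : dyAll.Countable := countable_iUnion fun _ => countable_range _

lemma exists_dyAll_between {a b : ℝ≥0} (h : a < b) : ∃ s ∈ dyAll, a < s ∧ s < b := by
  have hba : (0 : ℝ) < (b : ℝ) - a := by
    have : (a : ℝ) < b := by exact_mod_cast h
    linarith
  obtain ⟨n, hn⟩ := exists_pow_lt_of_lt_one hba (show (1 / 2 : ℝ) < 1 by norm_num)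
  have h2 : (0 : ℝ) < 2 ^ n := by positivity
  refine ⟨dyGrid n (⌊(a : ℝ) * 2 ^ n⌋₊ + 1), mem_iUnion.2 ⟨n, _, rfl⟩, ?_, ?_⟩
  · rw [← NNReal.coe_lt_coe]
    simp only [dyGrid]
    push_cast
    rw [lt_div_iff₀ h2]
    exact Nat.lt_floor_add_one _
  · rw [← NNReal.coe_lt_coe]
    simp only [dyGrid]
    push_cast
    rw [div_lt_iff₀ h2]
    have h1 : (⌊(a : ℝ) * 2 ^ n⌋₊ : ℝ) ≤ a * 2 ^ n := Nat.floor_le (by positivity)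
    have h3 : (1 / 2 : ℝ) ^ n * 2 ^ n = 1 := by rw [← mul_pow]; norm_num
    nlinarith

lemma dyAll_dense : Dense dyAll :=
  dense_of_exists_between fun _ _ h => by
    obtain ⟨s, hs, h1, h2⟩ := exists_dyAll_between h
    exact ⟨s, hs, h1, h2⟩

/-- `k` successive upcrossings of `[a,b]` along `T` before time `u`. -/
def UC (T : Set ℝ≥0) (a b : ℝ) (f : ℝ≥0 → ℝ) : ℕ → ℝ≥0 → Prop
  | 0, _ => True
  | k + 1, u => ∃ s ∈ T, ∃ t ∈ T, s ≤ t ∧ t < u ∧ f s < a ∧ b < f t ∧ UC T a b f k s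

lemma UC.mono_set {S T : Set ℝ≥0} (h : S ⊆ T) {a b : ℝ} {f : ℝ≥0 → ℝ} :
    ∀ {k : ℕ} {u : ℝ≥0}, UC S a b f k u → UC T a b f k u
  | 0, _, _ => trivial
  | _ + 1, _, ⟨s, hs, t, ht, h1, h2, h3, h4, h5⟩ =>
    ⟨s, h hs, t, h ht, h1, h2, h3, h4, h5.mono_set h⟩

lemma UC.mono_right {T : Set ℝ≥0} {a b : ℝ} {f : ℝ≥0 → ℝ} {k : ℕ} {u v : ℝ≥0} (huv : u ≤ v)
    (h : UC T a b f k u) : UC T a b f k v := by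
  cases k with
  | zero => trivial
  | succ k =>
    obtain ⟨s, hs, t, ht, h1, h2, h3⟩ := h
    exact ⟨s, hs, t, ht, h1, h2.trans_le huv, h3⟩

lemma UC.exists_level {a b : ℝ} {f : ℝ≥0 → ℝ} :
    ∀ {k : ℕ} {u : ℝ≥0}, UC dyAll a b f k u → ∃ n, UC (dyLevel n) a b f k u
  | 0, _, _ => ⟨0, trivial⟩
  | k + 1, u, ⟨s, hs, t, ht, h1, h2, h3, h4, h5⟩ => by
    obtain ⟨n1, hn1⟩ := mem_iUnion.1 hs
    obtain ⟨n2, hn2⟩ := mem_iUnion.1 ht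
    obtain ⟨n3, hn3⟩ := h5.exists_level
    refine ⟨max n1 (max n2 n3), s, dyLevel_mono (by simp) hn1, t, dyLevel_mono (by simp) hn2,
      h1, h2, h3, h4, hn3.mono_set (dyLevel_mono (by simp))⟩

lemma UC.le_upcrossingsBefore {Ω : Type*} {a b : ℝ} (hab : a < b) {g : ℝ≥0 → Ω → ℝ} {ω : Ω} {n : ℕ} :
    ∀ {k N : ℕ}, UC (dyLevel n) a b (fun t => g t ω) k (dyGrid n N) →
      k ≤ upcrossingsBefore a b (fun j => g (dyGrid n j)) N ω
  | 0, _, _ => Nat.zero_le _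
  | k + 1, N, ⟨_, ⟨N1, rfl⟩, _, ⟨N2, rfl⟩, h1, h2, h3, h4, h5⟩ => by
    have ih := h5.le_upcrossingsBefore hab
    have hN12 : N1 ≤ N2 := (dyGrid_strictMono n).le_iff_le.1 h1
    have hN2 : N2 < N := (dyGrid_strictMono n).lt_iff_lt.1 h2
    have := upcrossingsBefore_lt_of_exists_upcrossing (f := fun j => g (dyGrid n j)) (ω := ω)
      hab (le_refl N1) h3 hN12 h4
    have h6 := upcrossingsBefore_mono (f := fun j => g (dyGrid n j)) hab
      (show N2 + 1 ≤ N by omega) ω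
    simp only at h6
    omega

lemma UC.le_upcrossings {Ω : Type*} {a b : ℝ} (hab : a < b) {g : ℝ≥0 → Ω → ℝ} {ω : Ω} {n : ℕ}
    {k : ℕ} {u : ℝ≥0} (h : UC (dyLevel n) a b (fun t => g t ω) k u) :
      (k : ℝ≥0∞) ≤ upcrossings a b (fun j => g (dyGrid n j)) ω := by
  obtain ⟨N, hN⟩ := exists_nat_ge (u * 2 ^ n)
  have : u ≤ dyGrid n N := by
    unfold dyGrid
    rw [le_div_iff₀ (by positivity)]
    exact hN
  have h1 := (h.mono_right this).le_upcrossingsBefore hab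
  refine le_trans ?_ (le_iSup _ N)
  exact_mod_cast h1

lemma no_UC_left {a b : ℝ} {f : ℝ≥0 → ℝ} {t : ℝ≥0}
    (h1 : ∃ᶠ s in nhdsWithin t (Iio t ∩ dyAll), f s < a)
    (h2 : ∃ᶠ s in nhdsWithin t (Iio t ∩ dyAll), b < f s) (k : ℕ) :
    ∃ u < t, UC dyAll a b f k u := by
  have key : ∀ u < t, ∀ᶠ s in nhdsWithin t (Iio t ∩ dyAll), u < s ∧ s < t ∧ s ∈ dyAll := by
    intro u hu
    filter_upwards [self_mem_nhdsWithin, mem_nhdsWithin_of_mem_nhds (Ioi_mem_nhds hu)]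
      with s hs hs'
    exact ⟨hs', hs.1, hs.2⟩
  have hex : ∃ u, u < t := by
    obtain ⟨s, hs⟩ := (h1.and_eventually self_mem_nhdsWithin).exists
    exact ⟨s, hs.2.1⟩
  induction k with
  | zero =>
    obtain ⟨u, hu⟩ := hex
    exact ⟨u, hu, trivial⟩
  | succ k ih =>
    obtain ⟨u, hu, hk⟩ := ih
    obtain ⟨s, hs, hus, hst, hsD⟩ := (h1.and_eventually (key u hu)).exists
    obtain ⟨s', hs', hus', hst', hsD'⟩ := (h2.and_eventually (key s hst)).exists
    obtain ⟨v, hv1, hv2⟩ := exists_between hst'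
    exact ⟨v, hv2, s, hsD, s', hsD', hus'.le, hv1, hs, hs', hk.mono_right hus.le⟩

lemma no_UC_right {a b : ℝ} {f : ℝ≥0 → ℝ} {t : ℝ≥0}
    (h1 : ∃ᶠ s in nhdsWithin t (Ioi t ∩ dyAll), f s < a)
    (h2 : ∃ᶠ s in nhdsWithin t (Ioi t ∩ dyAll), b < f s) (k : ℕ) :
    ∀ u > t, UC dyAll a b f k u := by
  have key : ∀ u > t, ∀ᶠ s in nhdsWithin t (Ioi t ∩ dyAll), s < u ∧ t < s ∧ s ∈ dyAll := by
    intro u hu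
    filter_upwards [self_mem_nhdsWithin, mem_nhdsWithin_of_mem_nhds (Iio_mem_nhds hu)]
      with s hs hs'
    exact ⟨hs', hs.1, hs.2⟩
  induction k with
  | zero => intro u hu; trivial
  | succ k ih =>
    intro u hu
    obtain ⟨s', hs', hus', hst', hsD'⟩ := (h2.and_eventually (key u hu)).exists
    obtain ⟨s, hs, hus, hst, hsD⟩ := (h1.and_eventually (key s' hst')).exists
    exact ⟨s, hsD, s', hsD', hus.le, hus', hs, hs', ih s hst⟩

/-- Regularity of a real path along dyadics. -/
lemma exists_lims_real {f : ℝ≥0 → ℝ} {C : ℝ} (hC : ∀ s ∈ dyAll, |f s| ≤ C)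
    (hU : ∀ a b : ℚ, a < b → ∃ k, ∀ u, ¬ UC dyAll a b f k u) (t : ℝ≥0) :
    (∃ L, Tendsto f (nhdsWithin t (Ioi t ∩ dyAll)) (nhds L)) ∧
    (∃ L, Tendsto f (nhdsWithin t (Iio t ∩ dyAll)) (nhds L)) := by
  have hb : ∀ S : Set ℝ≥0, (nhdsWithin t (S ∩ dyAll)).IsBoundedUnder (· ≤ ·) f := fun S =>
    isBoundedUnder_of_eventually_le (a := C) (by
      filter_upwards [self_mem_nhdsWithin] with s hs using (abs_le.1 (hC s hs.2)).2)
  have hb' : ∀ S : Set ℝ≥0, (nhdsWithin t (S ∩ dyAll)).IsBoundedUnder (· ≥ ·) f := fun S =>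
    isBoundedUnder_of_eventually_ge (a := -C) (by
      filter_upwards [self_mem_nhdsWithin] with s hs using (abs_le.1 (hC s hs.2)).1)
  constructor
  · refine tendsto_of_no_upcrossings (s := range ((↑) : ℚ → ℝ)) Rat.denseRange_cast ?_ (hb _) (hb' _)
    rintro _ ⟨a, rfl⟩ _ ⟨b, rfl⟩ hab ⟨h1, h2⟩
    obtain ⟨k, hk⟩ := hU a b (by exact_mod_cast hab)
    exact hk _ (no_UC_right h1 h2 k (t + 1) (lt_add_one t))
  · refine tendsto_of_no_upcrossings (s := range ((↑) : ℚ → ℝ)) Rat.denseRange_cast ?_ (hb _) (hb' _)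
    rintro _ ⟨a, rfl⟩ _ ⟨b, rfl⟩ hab ⟨h1, h2⟩
    obtain ⟨k, hk⟩ := hU a b (by exact_mod_cast hab)
    obtain ⟨u, -, hu⟩ := no_UC_left h1 h2 k
    exact hk _ hu

/-- Restriction of a filtration to a dyadic grid. -/
def gridFil {Ω : Type*} {m : MeasurableSpace Ω} (F : Filtration ℝ≥0 m) (n : ℕ) : Filtration ℕ m where
  seq k := F (dyGrid n k)
  mono' _ _ h := F.mono ((dyGrid_strictMono n).monotone h)
  le' _ := F.le _

lemma ae_no_UC {Ω : Type*} {m : MeasurableSpace Ω} {P : Measure Ω} [IsProbabilityMeasure P]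
    (F : Filtration ℝ≥0 m) {g : ℝ≥0 → Ω → ℝ} (hg : Martingale g F P) {C : ℝ}
    (hC : ∀ t, ∫ ω, |g t ω| ∂P ≤ C) {a b : ℝ} (hab : a < b) :
    ∀ᵐ ω ∂P, ∃ k, ∀ u, ¬ UC dyAll a b (fun t => g t ω) k u := by
  set K : ℝ≥0∞ := ENNReal.ofReal (C + |a|) / ENNReal.ofReal (b - a) with hK
  have hba : ENNReal.ofReal (b - a) ≠ 0 := by simp [hab]
  have hKtop : K ≠ ∞ := ENNReal.div_ne_top ENNReal.ofReal_ne_top hba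
  have hup : ∀ n, ∫⁻ ω, upcrossings a b (fun j => g (dyGrid n j)) ω ∂P ≤ K := by
    intro n
    have hm : Martingale (fun j => g (dyGrid n j)) (gridFil F n) P :=
      ⟨fun j => hg.1 _, fun i j hij => hg.2 _ _ ((dyGrid_strictMono n).monotone hij)⟩
    have h := hm.submartingale.mul_lintegral_upcrossings_le_lintegral_pos_part a b
    rw [hK, ENNReal.le_div_iff_mul_le (Or.inl hba) (Or.inl ENNReal.ofReal_ne_top), mul_comm]
    refine h.trans (iSup_le fun N => ?_)
    have hgInt : Integrable (g (dyGrid n N)) P := hg.integrable _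
    calc ∫⁻ ω, ENNReal.ofReal ((g (dyGrid n N) ω - a)⁺) ∂P
        ≤ ∫⁻ ω, ENNReal.ofReal (|g (dyGrid n N) ω| + |a|) ∂P := by
          refine lintegral_mono fun ω => ENNReal.ofReal_le_ofReal ?_
          rw [posPart_def]
          refine sup_le ?_ (by positivity)
          have := le_abs_self (g (dyGrid n N) ω)
          have := neg_abs_le a
          linarith
      _ = ENNReal.ofReal (∫ ω, (|g (dyGrid n N) ω| + |a|) ∂P) := by
          have hgInt2 : Integrable (fun ω => |g (dyGrid n N) ω| + |a|) P :=
            hgInt.abs.add (integrable_const _)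
          rw [ofReal_integral_eq_lintegral_ofReal hgInt2]
          exact Eventually.of_forall fun ω => by positivity
      _ ≤ _ := by
          refine ENNReal.ofReal_le_ofReal ?_
          rw [integral_add hgInt.abs (integrable_const _)]
          simpa using hC (dyGrid n N)
  have hA : ∀ k : ℕ, k ≠ 0 → P {ω | ∃ u, UC dyAll a b (fun t => g t ω) k u} ≤ K / k := by
    intro k hk
    have hset : {ω | ∃ u, UC dyAll a b (fun t => g t ω) k u}
        ⊆ ⋃ n, {ω | ∃ u, UC (dyLevel n) a b (fun t => g t ω) k u} := by
      rintro ω ⟨u, hu⟩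
      obtain ⟨n, hn⟩ := hu.exists_level
      exact mem_iUnion.2 ⟨n, u, hn⟩
    refine (measure_mono hset).trans ?_
    rw [Monotone.measure_iUnion]
    · refine iSup_le fun n => ?_
      have hm : StronglyAdapted (gridFil F n) (fun j => g (dyGrid n j)) := fun j => hg.1 _
      have hmeas := hm.measurable_upcrossings hab
      have : {ω | ∃ u, UC (dyLevel n) a b (fun t => g t ω) k u} ⊆
          {ω | (k : ℝ≥0∞) ≤ upcrossings a b (fun j => g (dyGrid n j)) ω} := by
        rintro ω ⟨u, hu⟩
        exact hu.le_upcrossings hab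
      refine (measure_mono this).trans ?_
      refine (meas_ge_le_lintegral_div hmeas.aemeasurable (by simpa using hk) (by simp)).trans ?_
      gcongr
      exact hup n
    · intro n n' hnn' ω
      rintro ⟨u, hu⟩
      exact ⟨u, hu.mono_set (dyLevel_mono hnn')⟩
  have hlim : Tendsto (fun k : ℕ => K / k) atTop (nhds 0) := by
    simpa [div_eq_mul_inv] using
      ENNReal.Tendsto.const_mul ENNReal.tendsto_inv_nat_nhds_zero (Or.inr hKtop)
  rw [ae_iff]
  refine le_antisymm (ge_of_tendsto hlim ?_) (zero_le)
  filter_upwards [eventually_ne_atTop 0] with k hk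
  refine (measure_mono ?_).trans (hA k hk)
  intro ω hω
  simp only [not_exists, not_forall, not_not, mem_ofPred_eq] at hω ⊢
  exact hω k

/-- Doob's maximal inequality along dyadics. -/
lemma doob_dy {Ω : Type*} {m : MeasurableSpace Ω} {P : Measure Ω} [IsProbabilityMeasure P]
    (F : Filtration ℝ≥0 m) {E : Type*} [NormedAddCommGroup E] [NormedSpace ℝ E] [CompleteSpace E]
    (Y : Ω → E) (c : ℝ≥0) :
    c * P {ω | ∃ s ∈ dyAll, (c : ℝ) < ‖(P[Y | F s]) ω‖} ≤ ENNReal.ofReal (∫ ω, ‖Y ω‖ ∂P) := by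
  set Z : ℝ≥0 → Ω → ℝ := fun t => P[(fun ω => ‖Y ω‖) | F t] with hZ
  have hZm : Martingale Z F P := martingale_condExp _ _ _
  have hle : ∀ᵐ ω ∂P, ∀ s ∈ dyAll, ‖(P[Y | F s]) ω‖ ≤ Z s ω :=
    (ae_ball_iff dyAll_countable).2 fun s _ => norm_condExp_le Y
  have h1 : P {ω | ∃ s ∈ dyAll, (c : ℝ) < ‖(P[Y | F s]) ω‖}
      ≤ P (⋃ n, ⋃ N, {ω | ∃ j ≤ N, (c : ℝ) ≤ (Z (dyGrid n j) ω)⁺}) := by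
    refine measure_mono_ae ?_
    filter_upwards [hle] with ω hω h
    obtain ⟨s, hs, hcs⟩ := h
    obtain ⟨n, k, hk⟩ := mem_iUnion.1 hs
    refine mem_iUnion.2 ⟨n, mem_iUnion.2 ⟨k, k, le_rfl, ?_⟩⟩
    rw [hk]
    exact hcs.le.trans ((hω s hs).trans (le_posPart _))
  refine (mul_le_mul_right h1 _).trans ?_
  rw [Monotone.measure_iUnion]
  swap
  · intro n n' hnn' ω hω
    obtain ⟨N, j, hj, hc⟩ := mem_iUnion.1 hω
    obtain ⟨j', hj'⟩ := dyLevel_mono hnn' ⟨j, rfl⟩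
    exact mem_iUnion.2 ⟨j', j', le_rfl, by rw [hj']; exact hc⟩
  rw [ENNReal.mul_iSup]
  refine iSup_le fun n => ?_
  rw [Monotone.measure_iUnion]
  swap
  · rintro N N' h ω ⟨j, hj, hc⟩
    exact ⟨j, hj.trans h, hc⟩
  rw [ENNReal.mul_iSup]
  refine iSup_le fun N => ?_
  have hm : Martingale (fun j => Z (dyGrid n j)) (gridFil F n) P :=
      ⟨fun j => hZm.1 _, fun i j hij => hZm.2 _ _ ((dyGrid_strictMono n).monotone hij)⟩
  have hsub := hm.submartingale.pos
  have := maximal_ineq hsub (fun j ω => posPart_nonneg _) (ε := c) N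
  have hset : {ω | ∃ j ≤ N, (c : ℝ) ≤ (Z (dyGrid n j) ω)⁺} ⊆
    {ω | (c : ℝ) ≤ (Finset.range (N + 1)).sup' Finset.nonempty_range_add_one
      fun k => ((fun j => Z (dyGrid n j))⁺) k ω} := by
    rintro ω ⟨j, hj, hc⟩
    simp only [mem_ofPred_eq, Finset.le_sup'_iff]
    exact ⟨j, by simp; omega, hc⟩
  refine (mul_le_mul_right (measure_mono hset) _).trans (this.trans ?_)
  refine ENNReal.ofReal_le_ofReal ?_
  refine (setIntegral_le_integral (hsub.integrable N) (Eventually.of_forall fun ω => posPart_nonneg _)).trans ?_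
  have hnn : ∀ᵐ ω ∂P, 0 ≤ Z (dyGrid n N) ω := condExp_nonneg (Eventually.of_forall fun ω => norm_nonneg _)
  have : (fun ω => ((fun j => Z (dyGrid n j))⁺) N ω) =ᵐ[P] Z (dyGrid n N) := by
    filter_upwards [hnn] with ω hω
    exact posPart_of_nonneg hω
  rw [integral_congr_ae this, hZ]
  exact (integral_condExp (F.le _)).le


/-- Bounded paths. -/
abbrev BPath (d : ℕ) := lp (fun _ : ℝ≥0 => EuclideanSpace ℝ (Fin d)) ∞

lemma isClosed_hasLim {d : ℕ} (l : Filter ℝ≥0) :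
    IsClosed {f : BPath d | ∃ L, Tendsto (fun t => f t) l (nhds L)} := by
  rcases l.eq_or_neBot with rfl | hl
  · simp
  refine isClosed_of_closure_subset fun f hf => ?_
  have : Cauchy (map (fun t => f t) l) := by
    rw [Metric.cauchy_iff]
    refine ⟨inferInstance, fun ε hε => ?_⟩
    obtain ⟨h, ⟨L, hL⟩, hh⟩ := Metric.mem_closure_iff.1 hf (ε / 4) (by positivity)
    have hev := Metric.tendsto_nhds.1 hL (ε / 4) (by positivity)
    refine ⟨_, image_mem_map hev, ?_⟩
    rintro _ ⟨s, hs, rfl⟩ _ ⟨t, ht, rfl⟩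
    have key : ∀ u, dist (f u) (h u) < ε / 4 := fun u => by
      rw [dist_eq_norm] at hh ⊢
      exact (lp.norm_apply_le_norm ENNReal.top_ne_zero (f - h) u).trans_lt hh
    have h1 := key s
    have h2 := key t
    have h3 : dist (h s) L < ε / 4 := hs
    have h4 : dist (h t) L < ε / 4 := ht
    have := dist_triangle4 (f s) (h s) (h t) (f t)
    have := dist_triangle_right (h s) (h t) L
    rw [dist_comm (h t) (f t)] at *
    linarith
  exact CompleteSpace.complete this

/-- The space of bounded càdlàg paths. -/
def cad (d : ℕ) : Submodule ℝ (BPath d) where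
  carrier := {f | ∀ t, (∃ L, Tendsto (fun t => f t) (nhdsWithin t (Ici t)) (nhds L)) ∧
    (∃ L, Tendsto (fun t => f t) (nhdsWithin t (Iio t)) (nhds L))}
  add_mem' := by
    intro f g hf hg t
    obtain ⟨⟨L1, h1⟩, ⟨L2, h2⟩⟩ := hf t
    obtain ⟨⟨L3, h3⟩, ⟨L4, h4⟩⟩ := hg t
    exact ⟨⟨_, h1.add h3⟩, ⟨_, h2.add h4⟩⟩
  zero_mem' := fun t => ⟨⟨0, tendsto_const_nhds⟩, ⟨0, tendsto_const_nhds⟩⟩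
  smul_mem' := by
    intro c f hf t
    obtain ⟨⟨L1, h1⟩, ⟨L2, h2⟩⟩ := hf t
    exact ⟨⟨_, h1.const_smul c⟩, ⟨_, h2.const_smul c⟩⟩

lemma isClosed_cad (d : ℕ) : IsClosed (cad d : Set (BPath d)) := by
  have : (cad d : Set (BPath d)) = ⋂ t : ℝ≥0,
      ({f : BPath d | ∃ L, Tendsto (fun t => f t) (nhdsWithin t (Ici t)) (nhds L)} ∩
      {f : BPath d | ∃ L, Tendsto (fun t => f t) (nhdsWithin t (Iio t)) (nhds L)}) := by
    ext f
    simp only [mem_iInter]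
    rfl
  rw [this]
  exact isClosed_iInter fun t => (isClosed_hasLim _).inter (isClosed_hasLim _)

lemma cad_rightCont {d : ℕ} {f : BPath d} (hf : f ∈ cad d) (t : ℝ≥0) :
    ContinuousWithinAt (fun s => f s) (Ici t) t := by
  obtain ⟨L, hL⟩ := (hf t).1
  exact continuousWithinAt_of_tendsto_nhds hL
  where
  continuousWithinAt_of_tendsto_nhds {L : EuclideanSpace ℝ (Fin d)}
      (hL : Tendsto (fun s => f s) (nhdsWithin t (Ici t)) (nhds L)) :
      ContinuousWithinAt (fun s => f s) (Ici t) t := by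
    have : L = f t := by
      have h1 : Tendsto (fun s => f s) (pure t) (nhds L) :=
        hL.mono_left (pure_le_nhdsWithin self_mem_Ici)
      exact tendsto_nhds_unique h1 (tendsto_pure_nhds (fun s => f s) t)
    rw [this] at hL
    exact hL

instance dyRight_neBot (u : ℝ≥0) : (nhdsWithin u (Ioi u ∩ dyAll)).NeBot := by
  rw [← mem_closure_iff_nhdsWithin_neBot]
  have := closure_minimal (dyAll_dense.open_subset_closure_inter (isOpen_Ioi (a := u)))
    isClosed_closure
  apply this
  rw [closure_Ioi' ⟨u + 1, by simp⟩]
  exact self_mem_Ici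

lemma tendsto_of_dy {E : Type*} [PseudoMetricSpace E] {f N : ℝ≥0 → E}
    (hN : ∀ u, Tendsto f (nhdsWithin u (Ioi u ∩ dyAll)) (nhds (N u))) {t : ℝ≥0} {S : Set ℝ≥0}
    (hS : IsOpen S) {L : E} (hL : Tendsto f (nhdsWithin t (S ∩ dyAll)) (nhds L)) :
    Tendsto N (nhdsWithin t S) (nhds L) := by
  rw [(closed_nhds_basis L).tendsto_right_iff]
  rintro C ⟨hC, hCc⟩
  obtain ⟨V, hVo, htV, hV⟩ := mem_nhdsWithin.1 (hL hC)
  filter_upwards [self_mem_nhdsWithin, mem_nhdsWithin_of_mem_nhds (hVo.mem_nhds htV)] with u huS huV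
  refine hCc.mem_of_tendsto (hN u) ?_
  filter_upwards [self_mem_nhdsWithin,
    mem_nhdsWithin_of_mem_nhds ((hVo.inter hS).mem_nhds ⟨huV, huS⟩)] with s hs hs'
  exact hV ⟨hs'.1, hs'.2, hs.2⟩

/-- Vector valued version of path regularity. -/
lemma exists_lims_vec {d : ℕ} {f : ℝ≥0 → EuclideanSpace ℝ (Fin d)} {C : ℝ}
    (hC : ∀ s ∈ dyAll, ‖f s‖ ≤ C)
    (hU : ∀ i, ∀ a b : ℚ, a < b → ∃ k, ∀ u, ¬ UC dyAll a b (fun t => f t i) k u) (t : ℝ≥0) :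
    (∃ L, Tendsto f (nhdsWithin t (Ioi t ∩ dyAll)) (nhds L)) ∧
    (∃ L, Tendsto f (nhdsWithin t (Iio t ∩ dyAll)) (nhds L)) := by
  have h := fun i => exists_lims_real (f := fun t => f t i) (C := C)
    (fun s hs => (PiLp.norm_apply_le (f s) i).trans (hC s hs)) (hU i) t
  choose L1 hL1 using fun i => (h i).1
  choose L2 hL2 using fun i => (h i).2
  have key : ∀ (l : Filter ℝ≥0) (L : Fin d → ℝ), (∀ i, Tendsto (fun t => f t i) l (nhds (L i))) →
      Tendsto f l (nhds (WithLp.toLp 2 L)) := by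
    intro l L hL
    have h1 : Tendsto (fun t => WithLp.ofLp (f t)) l (nhds L) := tendsto_pi_nhds.2 hL
    exact ((PiLp.continuous_toLp 2 _).tendsto L).comp h1
  exact ⟨⟨_, key _ _ hL1⟩, ⟨_, key _ _ hL2⟩⟩

lemma ae_bdd_dy {Ω : Type*} {m : MeasurableSpace Ω} {P : Measure Ω} [IsProbabilityMeasure P]
    (F : Filtration ℝ≥0 m) {d : ℕ} (Y : Ω → EuclideanSpace ℝ (Fin d)) :
    ∀ᵐ ω ∂P, ∃ C : ℝ, ∀ s ∈ dyAll, ‖(P[Y | F s]) ω‖ ≤ C := by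
  set K := ENNReal.ofReal (∫ ω, ‖Y ω‖ ∂P)
  have hA : ∀ k : ℕ, k ≠ 0 → P {ω | ∃ s ∈ dyAll, (k : ℝ) < ‖(P[Y | F s]) ω‖} ≤ K / k := by
    intro k hk
    rw [ENNReal.le_div_iff_mul_le (Or.inl (by simpa using hk)) (Or.inl (by simp)), mul_comm]
    simpa using doob_dy F Y (k : ℝ≥0)
  have hlim : Tendsto (fun k : ℕ => K / k) atTop (nhds 0) := by
    simpa [div_eq_mul_inv] using
      ENNReal.Tendsto.const_mul ENNReal.tendsto_inv_nat_nhds_zero (Or.inr ENNReal.ofReal_ne_top)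
  rw [ae_iff]
  refine le_antisymm (ge_of_tendsto hlim ?_) (zero_le)
  filter_upwards [eventually_ne_atTop 0] with k hk
  refine (measure_mono ?_).trans (hA k hk)
  intro ω hω
  simp only [not_exists, not_forall, not_le, mem_ofPred_eq] at hω ⊢
  obtain ⟨s, hs, h⟩ := hω k
  exact ⟨s, hs, h⟩

lemma ae_no_UC_vec {Ω : Type*} {m : MeasurableSpace Ω} {P : Measure Ω} [IsProbabilityMeasure P]
    (F : Filtration ℝ≥0 m) {d : ℕ} (Y : Ω → EuclideanSpace ℝ (Fin d)) (hY : Integrable Y P) :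
    ∀ᵐ ω ∂P, ∀ i, ∀ a b : ℚ, a < b →
      ∃ k, ∀ u, ¬ UC dyAll a b (fun t => (P[Y | F t]) ω i) k u := by
  rw [ae_all_iff]; intro i
  rw [ae_all_iff]; intro a
  rw [ae_all_iff]; intro b
  by_cases hab : a < b
  swap
  · exact Eventually.of_forall fun ω h => absurd h hab
  have hm : Martingale (fun t ω => (P[Y | F t]) ω i) F P := by
    refine (martingale_condExp (fun ω => Y ω i) F P).congr ?_ ?_
    · intro t
      have h1 : StronglyMeasurable[F t] (P[Y | F t]) := stronglyMeasurable_condExp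
      exact (EuclideanSpace.proj (𝕜 := ℝ) i).continuous.comp_stronglyMeasurable h1
    · intro t
      exact ((EuclideanSpace.proj (𝕜 := ℝ) i).comp_condExp_comm hY).symm
  have := ae_no_UC F hm (C := ∫ ω, ‖Y ω‖ ∂P) (fun t => ?_) (a := a) (b := b) (by exact_mod_cast hab)
  · filter_upwards [this] with ω h _ using h
  · calc ∫ ω, |(P[Y | F t]) ω i| ∂P ≤ ∫ ω, (P[fun ω => ‖Y ω‖ | F t]) ω ∂P := by
          refine integral_mono_ae (hm.integrable t).abs integrable_condExp ?_
          filter_upwards [norm_condExp_le (m := F t) (μ := P) Y] with ω hω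
          exact (PiLp.norm_apply_le _ i).trans hω
      _ = _ := integral_condExp (F.le t)

lemma unifInt_vec {Ω : Type*} {m : MeasurableSpace Ω} {P : Measure Ω} [IsProbabilityMeasure P]
    (F : Filtration ℝ≥0 m) {d : ℕ} (Y : Ω → EuclideanSpace ℝ (Fin d)) (hY : Integrable Y P)
    (s : ℕ → ℝ≥0) : UniformIntegrable (fun n => P[Y | F (s n)]) 1 P := by
  obtain ⟨-, h2, C, h3⟩ := hY.norm.uniformIntegrable_condExp (fun n => F.le (s n))
  have hn : ∀ t, ∀ᵐ ω ∂P, ‖(P[Y | F t]) ω‖ ≤ ‖(P[fun ω => ‖Y ω‖ | F t]) ω‖ := fun t => by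
    filter_upwards [norm_condExp_le (m := F t) (μ := P) Y] with ω hω
    exact hω.trans (le_abs_self _)
  refine ⟨fun n => integrable_condExp.aestronglyMeasurable, fun ε hε => ?_, C, fun n =>
    (eLpNorm_mono_ae (hn _)).trans (h3 n)⟩
  obtain ⟨δ, hδ, h⟩ := h2 hε
  refine ⟨δ, hδ, fun n A hA hPA => (eLpNorm_mono_ae ?_).trans (h n A hA hPA)⟩
  filter_upwards [hn (s n)] with ω hω
  by_cases hωA : ω ∈ A
  · simpa [hωA] using hω
  · simp [hωA]

/-- Existence of a bounded càdlàg version, with the maximal inequality. -/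
lemma exists_cadlag {Ω : Type*} {m : MeasurableSpace Ω} {P : Measure Ω} [IsProbabilityMeasure P]
    (F : Filtration ℝ≥0 m)
    (hright : ∀ t : ℝ≥0, (F t : MeasurableSpace Ω) = ⨅ (s : ℝ≥0) (_ : t < s), F s)
    (hcomplete : ∀ s : Set Ω, MeasurableSet[m] s → P s = 0 → MeasurableSet[F 0] s)
    {d : ℕ} (Y : Ω → EuclideanSpace ℝ (Fin d)) (hY : Integrable Y P) :
    ∃ N : Ω → BPath d, (∀ ω, N ω ∈ cad d) ∧ (∀ t, (fun ω => N ω t) =ᵐ[P] P[Y | F t]) ∧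
      ∀ c : ℝ≥0, c * P {ω | (c : ℝ) < ‖N ω‖} ≤ ENNReal.ofReal (∫ ω, ‖Y ω‖ ∂P) := by
  classical
  have hgood := (ae_bdd_dy (P := P) F Y).and (ae_no_UC_vec F Y hY)
  set B := toMeasurable P {ω | ¬ ((∃ C : ℝ, ∀ s ∈ dyAll, ‖(P[Y | F s]) ω‖ ≤ C) ∧ ∀ i, ∀ a b : ℚ, a < b →
      ∃ k, ∀ u, ¬ UC dyAll a b (fun t => (P[Y | F t]) ω i) k u)} with hB
  have hBm : MeasurableSet B := measurableSet_toMeasurable _ _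
  have hB0 : P B = 0 := by rw [hB, measure_toMeasurable]; exact hgood
  have hBF : ∀ t, MeasurableSet[F t] B := fun t => F.mono (zero_le) _ (hcomplete B hBm hB0)
  have hBc : ∀ ω ∉ B, (∃ C : ℝ, ∀ s ∈ dyAll, ‖(P[Y | F s]) ω‖ ≤ C) ∧ ∀ i, ∀ a b : ℚ, a < b →
      ∃ k, ∀ u, ¬ UC dyAll a b (fun t => (P[Y | F t]) ω i) k u := by
    intro ω hω
    by_contra h
    exact hω (subset_toMeasurable _ _ h)
  have hpath : ∀ ω, ∃ N : BPath d, N ∈ cad d ∧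
      (∀ t, Tendsto (fun s => Bᶜ.indicator (P[Y | F s]) ω) (nhdsWithin t (Ioi t ∩ dyAll)) (nhds (N t))) ∧
      (∀ c : ℝ, 0 ≤ c → (∀ s ∈ dyAll, ‖(P[Y | F s]) ω‖ ≤ c) → ‖N‖ ≤ c) := by
    intro ω
    by_cases hω : ω ∈ B
    · refine ⟨0, zero_mem _, fun t => ?_, fun c hc _ => by simpa using hc⟩
      simp [hω]
    · obtain ⟨⟨C, hC⟩, hU⟩ := hBc ω hω
      have hl := exists_lims_vec hC hU
      choose N hN using fun t => (hl t).1
      have hbd : ∀ c, (∀ s ∈ dyAll, ‖(P[Y | F s]) ω‖ ≤ c) → ∀ t, ‖N t‖ ≤ c := by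
        intro c hc t
        refine le_of_tendsto (hN t).norm ?_
        filter_upwards [self_mem_nhdsWithin] with s hs using hc s hs.2
      have hmem : Memℓp (E := fun _ : ℝ≥0 => EuclideanSpace ℝ (Fin d)) N ∞ := by
        refine memℓp_infty ⟨C, ?_⟩
        rintro _ ⟨t, rfl⟩
        exact hbd C hC t
      refine ⟨⟨N, hmem⟩, ?_, ?_, ?_⟩
      · intro t
        constructor
        · refine ⟨N t, ?_⟩
          have := tendsto_of_dy hN isOpen_Ioi (hN t)
          exact continuousWithinAt_Ioi_iff_Ici.1 this
        · obtain ⟨L, hL⟩ := (hl t).2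
          exact ⟨L, tendsto_of_dy hN isOpen_Iio hL⟩
      · intro t
        simpa [hω] using hN t
      · intro c hc h
        exact lp.norm_le_of_forall_le hc (hbd c h)
  choose N hNc hNt hNb using hpath
  refine ⟨N, hNc, fun t => ?_, fun c => ?_⟩
  · -- identification
    have hs : ∃ s : ℕ → ℝ≥0, Tendsto s atTop (nhdsWithin t (Ioi t ∩ dyAll)) :=
      exists_seq_tendsto _
    obtain ⟨s, hs⟩ := hs
    have hsev : ∀ᶠ n in atTop, t < s n := by
      filter_upwards [hs self_mem_nhdsWithin] with n hn using hn.1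
    obtain ⟨n0, hn0⟩ := eventually_atTop.1 hsev
    have hlim : ∀ ω, Tendsto (fun n => Bᶜ.indicator (P[Y | F (s n)]) ω) atTop (nhds (N ω t)) :=
      fun ω => (hNt ω t).comp hs
    have hae : ∀ᵐ ω ∂P, Tendsto (fun n => (P[Y | F (s n)]) ω) atTop (nhds (N ω t)) := by
      have : ∀ᵐ ω ∂P, ω ∉ B := measure_eq_zero_iff_ae_notMem.1 hB0
      filter_upwards [this] with ω hω
      simpa [hω] using hlim ω
    have hUI := unifInt_vec F Y hY s
    have hmeasr : ∀ r, t < r → Measurable[F r] (fun ω => N ω t) := by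
      intro r hr
      have : ∀ᶠ n in atTop, s n < r :=
        hs (mem_nhdsWithin_of_mem_nhds (Iio_mem_nhds hr))
      obtain ⟨n1, hn1⟩ := eventually_atTop.1 this
      refine @measurable_of_tendsto_metrizable _ _ (F r) _ _ _ _
        (fun n ω => Bᶜ.indicator (P[Y | F (s (n + n1))]) ω) _ (fun n => ?_)
        (tendsto_pi_nhds.2 fun ω => (tendsto_add_atTop_iff_nat n1).2 (hlim ω))
      have h1 : Measurable[F r] (P[Y | F (s (n + n1))]) :=
        (stronglyMeasurable_condExp.mono (F.mono (hn1 (n + n1) (by omega)).le)).measurable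
      exact h1.indicator (hBF r).compl
    have hmeas : Measurable[F t] (fun ω => N ω t) := by
      rw [hright t]
      intro A hA
      rw [MeasurableSpace.measurableSet_iInf]
      intro r
      rw [MeasurableSpace.measurableSet_iInf]
      intro hr
      exact hmeasr r hr hA
    have hNint : MemLp (fun ω => N ω t) 1 P :=
      hUI.memLp_of_tendstoInMeasure (tendstoInMeasure_of_tendsto_ae hUI.1 hae)
    have hL1 := tendsto_Lp_finite_of_tendsto_ae le_rfl ENNReal.one_ne_top hUI.1 hNint hUI.2.1 hae
    refine ae_eq_condExp_of_forall_setIntegral_eq (F.le t) hY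
      (fun A _ _ => (memLp_one_iff_integrable.1 hNint).integrableOn) (fun A hA _ => ?_)
      hmeas.stronglyMeasurable.aestronglyMeasurable
    have h1 := tendsto_setIntegral_of_L1' _ hNint.1
      (Eventually.of_forall fun n => integrable_condExp) hL1 A
    refine tendsto_nhds_unique h1 (tendsto_const_nhds.congr' ?_)
    filter_upwards [hsev] with n hn
    exact (setIntegral_condExp (F.le _) hY (F.mono hn.le _ hA)).symm
  · refine (mul_le_mul_right (measure_mono ?_) _).trans (doob_dy F Y c)
    intro ω hω
    by_contra h
    simp only [mem_ofPred_eq, not_exists, not_and, not_lt] at h hω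
    exact absurd (hNb ω c c.2 h) (not_le.2 hω)


lemma Lp_coe_sum {Ω : Type*} {m : MeasurableSpace Ω} {P : Measure Ω} {E ι : Type*}
    [NormedAddCommGroup E] (s : Finset ι) (f : ι → Lp E 1 P) :
    ((∑ i ∈ s, f i : Lp E 1 P) : Ω → E) =ᵐ[P] fun ω => ∑ i ∈ s, f i ω := by
  classical
  induction s using Finset.induction_on with
  | empty =>
    simp only [Finset.sum_empty]
    exact Lp.coeFn_zero E 1 P
  | insert a s ha ih =>
    rw [Finset.sum_insert ha]
    filter_upwards [ih, Lp.coeFn_add (f a) (∑ i ∈ s, f i)] with ω h1 h2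
    rw [h2, Finset.sum_insert ha, Pi.add_apply, h1]

/-- The monomial `v ↦ ∏ v_i (α i)`. -/
def monom {l n : ℕ} (α : Fin n → Fin l) :
    ContinuousMultilinearMap ℝ (fun _ : Fin n => EuclideanSpace ℝ (Fin l)) ℝ :=
  (ContinuousMultilinearMap.mkPiAlgebra ℝ (Fin n) ℝ).compContinuousLinearMap
    (fun i => EuclideanSpace.proj (𝕜 := ℝ) (α i))

lemma monom_apply {l n : ℕ} (α : Fin n → Fin l) (v : Fin n → EuclideanSpace ℝ (Fin l)) :
    monom α v = ∏ i, v i (α i) := by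
  simp [monom]

lemma multilinear_expand {l n : ℕ} {G : Type*} [NormedAddCommGroup G] [NormedSpace ℝ G]
    (p : ContinuousMultilinearMap ℝ (fun _ : Fin n => EuclideanSpace ℝ (Fin l)) G)
    (v : Fin n → EuclideanSpace ℝ (Fin l)) :
    p v = ∑ α : Fin n → Fin l, monom α v • p (fun i => EuclideanSpace.single (α i) (1 : ℝ)) := by
  classical
  have hv : v = fun i => ∑ j, v i j • EuclideanSpace.single j (1 : ℝ) := by
    funext i
    ext k
    simp [Finset.sum_apply, Pi.single_apply]
  conv_lhs => rw [hv]
  rw [ContinuousMultilinearMap.map_sum]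
  refine Finset.sum_congr rfl fun α _ => ?_
  rw [ContinuousMultilinearMap.map_smul_univ, monom_apply]

/-- Assembles multilinear coefficients. -/
def asm {l n d : ℕ} (N : (Fin n → Fin l) → BPath d) :
    ContinuousMultilinearMap ℝ (fun _ : Fin n => EuclideanSpace ℝ (Fin l)) (BPath d) :=
  ∑ α, (monom α).smulRight (N α)

lemma asm_apply {l n d : ℕ} (N : (Fin n → Fin l) → BPath d)
    (v : Fin n → EuclideanSpace ℝ (Fin l)) : asm N v = ∑ α, monom α v • N α := by
  simp [asm]

lemma asm_norm {l n d : ℕ} (N : (Fin n → Fin l) → BPath d) {B : ℝ} (hB : 0 ≤ B)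
    (hN : ∀ α, ‖N α‖ ≤ B) : ‖asm N‖ ≤ (l : ℝ) ^ n * B := by
  refine ContinuousMultilinearMap.opNorm_le_bound (by positivity) fun v => ?_
  rw [asm_apply]
  calc ‖∑ α, monom α v • N α‖ ≤ ∑ α : Fin n → Fin l, (∏ i, ‖v i‖) * B := by
        refine norm_sum_le_of_le _ fun α _ => ?_
        rw [norm_smul, monom_apply, norm_prod]
        refine mul_le_mul ?_ (hN α) (norm_nonneg _) (by positivity)
        exact Finset.prod_le_prod (fun i _ => norm_nonneg _) fun i _ => PiLp.norm_apply_le _ _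
    _ = _ := by
        simp
        ring

lemma asm_mem {l n d : ℕ} (N : (Fin n → Fin l) → BPath d) (hN : ∀ α, N α ∈ cad d)
    (v : Fin n → EuclideanSpace ℝ (Fin l)) : asm N v ∈ cad d := by
  rw [asm_apply]
  exact Submodule.sum_mem _ fun α _ => Submodule.smul_mem _ _ (hN α)

lemma exists_local {Ω : Type*} {m : MeasurableSpace Ω} {P : Measure Ω} [IsProbabilityMeasure P]
    (F : Filtration ℝ≥0 m)
    (hright : ∀ t : ℝ≥0, (F t : MeasurableSpace Ω) = ⨅ (s : ℝ≥0) (_ : t < s), F s)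
    (hcomplete : ∀ s : Set Ω, MeasurableSet[m] s → P s = 0 → MeasurableSet[F 0] s)
    {l d : ℕ} (ξ : EuclideanSpace ℝ (Fin l) → Lp (EuclideanSpace ℝ (Fin d)) 1 P)
    (y : EuclideanSpace ℝ (Fin l)) (hy : AnalyticAt ℝ ξ y) :
    ∃ R : ℝ, 0 < R ∧ ∃ Mb : EuclideanSpace ℝ (Fin l) → Ω → BPath d,
      (∀ ω, AnalyticOnNhd ℝ (fun x => Mb x ω) (Metric.ball y R)) ∧
      (∀ x ω, Mb x ω ∈ cad d) ∧
      ∀ x ∈ Metric.ball y R, ∀ t, (fun ω => Mb x ω t) =ᵐ[P]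
        P[(ξ x : Ω → EuclideanSpace ℝ (Fin d)) | F t] := by
  classical
  obtain ⟨p, r, hp⟩ := hy
  obtain ⟨C, ρ, hC, hρ, hpn⟩ := p.le_mul_pow_of_radius_pos hp.radius_pos
  lift C to ℝ≥0 using hC.le
  lift ρ to ℝ≥0 using hρ.le
  have hC : 0 < C := by exact_mod_cast hC
  have hρ : 0 < ρ := by exact_mod_cast hρ
  set Y : ∀ n, (Fin n → Fin l) → Lp (EuclideanSpace ℝ (Fin d)) 1 P := fun n α =>
    p n (fun i => EuclideanSpace.single (α i) (1 : ℝ)) with hYdef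
  have hYn : ∀ n α, ‖Y n α‖ ≤ C * ρ ^ n := fun n α => by
    refine (ContinuousMultilinearMap.le_opNorm _ _).trans ?_
    simpa using hpn n
  choose N hNc hNt hNd using fun n (α : Fin n → Fin l) =>
    exists_cadlag F hright hcomplete (Y n α) (L1.integrable_coeFn (Y n α))
  set B : ℝ≥0 := 2 * (l + 1) * ρ with hB
  have hBpos : 0 < B := by positivity
  have hBn : ∀ n α, P {ω | ((B ^ n : ℝ≥0) : ℝ) < ‖N n α ω‖} ≤ ((C * ρ ^ n / B ^ n : ℝ≥0) : ℝ≥0∞) := by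
    intro n α
    have h1 := hNd n α (B ^ n)
    have h2 : ENNReal.ofReal (∫ ω, ‖Y n α ω‖ ∂P) ≤ ((C * ρ ^ n : ℝ≥0) : ℝ≥0∞) := by
      rw [← L1.norm_eq_integral_norm, ← ENNReal.ofReal_coe_nnreal]
      refine ENNReal.ofReal_le_ofReal ?_
      exact_mod_cast hYn n α
    rw [ENNReal.coe_div (by positivity), ENNReal.le_div_iff_mul_le
      (Or.inl (by simp [hBpos.ne'])) (Or.inl ENNReal.coe_ne_top), mul_comm]
    exact h1.trans h2
  have hBC : ∀ᵐ ω ∂P, ∀ᶠ n in atTop, ω ∉ {ω | ∃ α, ((B ^ n : ℝ≥0) : ℝ) < ‖N n α ω‖} := by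
    refine ae_eventually_notMem ?_
    have hle : ∀ n, P {ω | ∃ α, ((B ^ n : ℝ≥0) : ℝ) < ‖N n α ω‖} ≤
        ((C * (1 / 2) ^ n : ℝ≥0) : ℝ≥0∞) := by
      intro n
      have : {ω | ∃ α, ((B ^ n : ℝ≥0) : ℝ) < ‖N n α ω‖} =
        ⋃ α, {ω | ((B ^ n : ℝ≥0) : ℝ) < ‖N n α ω‖} := by ext; simp
      rw [this]
      refine (measure_iUnion_fintype_le _ _).trans ?_
      refine (Finset.sum_le_sum fun α _ => hBn n α).trans ?_
      rw [Finset.sum_const, nsmul_eq_mul]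
      norm_cast
      simp only [Finset.card_univ, Fintype.card_fun, Fintype.card_fin]
      push_cast
      have e1 : (l : ℝ≥0) ^ n * (C * ρ ^ n / B ^ n) = C * (l * ρ / B) ^ n := by
        rw [div_pow, mul_pow]; ring
      have e2 : (l : ℝ≥0) * ρ / B ≤ 1 / 2 := by
        rw [hB, div_le_div_iff₀ (by positivity) (by positivity)]
        have : (l : ℝ≥0) * ρ ≤ (l + 1) * ρ := by gcongr; simp
        calc (l : ℝ≥0) * ρ * 2 ≤ (l + 1) * ρ * 2 := by gcongr
          _ = _ := by ring
      rw [e1]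
      exact mul_le_mul_right (pow_le_pow_left₀ (by positivity) e2 n) C
    refine ne_top_of_le_ne_top ?_ (ENNReal.tsum_le_tsum hle)
    rw [ENNReal.tsum_coe_ne_top_iff_summable]
    refine Summable.mul_left _ ?_
    rw [← NNReal.summable_coe]
    push_cast
    exact summable_geometric_of_lt_one (by norm_num) (by norm_num)
  set q : Ω → FormalMultilinearSeries ℝ (EuclideanSpace ℝ (Fin l)) (BPath d) := fun ω n =>
    asm (fun α => N n α ω) with hq
  set R1 : ℝ≥0 := 1 / ((l + 1) * B) with hR1
  have hR1pos : 0 < R1 := by positivity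
  set G : Set Ω := {ω | ∀ᶠ n in atTop, ∀ α, ‖N n α ω‖ ≤ B ^ n} with hG
  have hGae : ∀ᵐ ω ∂P, ω ∈ G := by
    filter_upwards [hBC] with ω hω
    filter_upwards [hω] with n hn α
    by_contra h
    exact hn ⟨α, by simpa using h⟩
  have hrad : ∀ ω ∈ G, (R1 : ℝ≥0∞) ≤ (q ω).radius := by
    intro ω hω
    refine FormalMultilinearSeries.le_radius_of_eventually_le _ 1 ?_
    filter_upwards [hω] with n hn
    have h1 := asm_norm (fun α => N n α ω) (by positivity) hn
    calc ‖q ω n‖ * (R1 : ℝ) ^ n ≤ ((l : ℝ) ^ n * B ^ n) * (R1 : ℝ) ^ n := by gcongr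
      _ = (l * B * R1) ^ n := by rw [mul_pow, mul_pow]
      _ ≤ 1 := by
        refine pow_le_one₀ (by positivity) ?_
        rw [hR1]
        push_cast
        have hB' : (0 : ℝ) < B := by exact_mod_cast hBpos
        rw [mul_one_div, div_le_one (by positivity)]
        nlinarith
  obtain ⟨r0, hr0, hr0r⟩ := ENNReal.lt_iff_exists_nnreal_btwn.1 hp.r_pos
  have hr0 : 0 < r0 := by exact_mod_cast hr0
  set R : ℝ≥0 := min r0 R1 with hR
  have hRpos : 0 < R := lt_min hr0 hR1pos
  have hser : ∀ ω ∈ G, HasFPowerSeriesOnBall (fun x => (q ω).sum (x - y)) (q ω) y R := by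
    intro ω hω
    have h0 : (0 : ℝ≥0∞) < R := by exact_mod_cast hRpos
    have h1 : (R : ℝ≥0∞) ≤ (q ω).radius :=
      le_trans (by exact_mod_cast min_le_right _ _) (hrad ω hω)
    have h2 := (((q ω).hasFPowerSeriesOnBall (h0.trans_le h1)).mono h0 h1).comp_sub y
    simpa using h2
  have hball : Metric.ball y R = Metric.eball y R := Metric.eball_coe.symm
  refine ⟨R, by exact_mod_cast hRpos, fun x ω => if ω ∈ G then (q ω).sum (x - y) else 0, ?_, ?_, ?_⟩
  · intro ω
    by_cases hω : ω ∈ G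
    · simp only [hω, if_true]
      rw [hball]
      exact (hser ω hω).analyticOnNhd
    · simp only [hω, if_false]
      exact analyticOnNhd_const
  · intro x ω
    by_cases hω : ω ∈ G
    · simp only [hω, if_true]
      exact tsum_mem (isClosed_cad d) fun n => asm_mem _ (fun α => hNc n α ω) _
    · simp only [hω, if_false]
      exact zero_mem _
  · intro x hx t
    rw [hball] at hx
    set T := condExpL1CLM (EuclideanSpace ℝ (Fin d)) (F.le t) P with hT
    have hTe : ∀ f : Lp (EuclideanSpace ℝ (Fin d)) 1 P,
        P[(f : Ω → EuclideanSpace ℝ (Fin d)) | F t] =ᵐ[P] T f := by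
      intro f
      have := condExp_ae_eq_condExpL1CLM (F.le t) (L1.integrable_coeFn f)
      rwa [Integrable.toL1_coeFn] at this
    refine EventuallyEq.trans ?_ (hTe (ξ x)).symm
    have hx' : x ∈ Metric.eball y r :=
      Metric.eball_subset_eball (le_trans (by exact_mod_cast min_le_left _ _) hr0r.le) hx
    have hsum := hp.hasSum_sub hx'
    have hterm : ∀ n, (T (p n fun _ => x - y) : Ω → EuclideanSpace ℝ (Fin d)) =ᵐ[P]
        fun ω => (q ω n fun _ => x - y) t := by
      intro n
      rw [multilinear_expand (p n), map_sum]
      refine (Lp_coe_sum _ _).trans ?_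
      have h1 : ∀ᵐ ω ∂P, ∀ α : Fin n → Fin l, T (monom α (fun _ => x - y) • Y n α) ω
          = monom α (fun _ => x - y) • N n α ω t := by
        rw [ae_all_iff]
        intro α
        rw [map_smul]
        filter_upwards [Lp.coeFn_smul (monom α (fun _ => x - y)) (T (Y n α)), hTe (Y n α), hNt n α t]
          with ω h1 h2 h3
        rw [h1, Pi.smul_apply, ← h2, ← h3]
      filter_upwards [h1] with ω hω
      simp only [hq, asm_apply]
      rw [lp.coeFn_sum, Finset.sum_apply]
      exact Finset.sum_congr rfl fun α _ => hω α
    have hpart : ∀ n, (T (∑ k ∈ Finset.range n, p k fun _ => x - y) : Ω → EuclideanSpace ℝ (Fin d))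
        =ᵐ[P] fun ω => ∑ k ∈ Finset.range n, (q ω k fun _ => x - y) t := by
      intro n
      rw [map_sum]
      refine (Lp_coe_sum _ _).trans ?_
      filter_upwards [ae_all_iff.2 hterm] with ω hω
      exact Finset.sum_congr rfl fun k _ => hω k
    have hTlim := (T.continuous.tendsto (ξ x)).comp hsum.tendsto_sum_nat
    obtain ⟨ns, hns, hlim⟩ := (tendstoInMeasure_of_tendsto_Lp hTlim).exists_seq_tendsto_ae
    filter_upwards [hlim, ae_all_iff.2 hpart, hGae] with ω h1 h2 h3
    simp only [h3, if_true]
    have h4 := (hser ω h3).hasSum_sub hx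
    have h5 := (lp.evalCLM ℝ (fun _ : ℝ≥0 => EuclideanSpace ℝ (Fin d)) ∞ t).hasSum h4
    have h6 := (h5.tendsto_sum_nat.comp hns.tendsto_atTop)
    refine tendsto_nhds_unique h6 (h1.congr fun i => ?_)
    exact h2 (ns i)


lemma cad_ext {d : ℕ} {f g : BPath d} (hf : f ∈ cad d) (hg : g ∈ cad d)
    (h : ∀ s ∈ dyAll, f s = g s) : f = g := by
  refine lp.ext ?_
  funext t
  have hle : nhdsWithin t (Ioi t ∩ dyAll) ≤ nhdsWithin t (Ici t) :=
    nhdsWithin_mono _ fun s hs => mem_Ici.2 (le_of_lt hs.1)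
  have h1 : Tendsto (fun s => f s) (nhdsWithin t (Ioi t ∩ dyAll)) (nhds (f t)) :=
    (cad_rightCont hf t).tendsto.mono_left hle
  have h2 : Tendsto (fun s => g s) (nhdsWithin t (Ioi t ∩ dyAll)) (nhds (g t)) :=
    (cad_rightCont hg t).tendsto.mono_left hle
  refine tendsto_nhds_unique h1 (h2.congr' ?_)
  filter_upwards [self_mem_nhdsWithin] with s hs
  exact (h s hs.2).symm

theorem analytic_field_of_martingales
    {Ω : Type*} {m : MeasurableSpace Ω} {P : Measure Ω} [IsProbabilityMeasure P]
    (F : Filtration ℝ≥0 m)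
    -- usual conditions: right-continuity and completeness of the filtration
    (hright : ∀ t : ℝ≥0, (F t : MeasurableSpace Ω) = ⨅ (s : ℝ≥0) (_ : t < s), F s)
    (hcomplete : ∀ s : Set Ω, MeasurableSet[m] s → P s = 0 → MeasurableSet[F 0] s)
    -- `F 0` is `P`-trivial and `F = ⋁ t, F t`
    (htrivial : ∀ s : Set Ω, MeasurableSet[F 0] s → P s = 0 ∨ P s = 1)
    (hgen : (⨆ t : ℝ≥0, (F t : MeasurableSpace Ω)) = m)
    {l d : ℕ}
    (U : Set (EuclideanSpace ℝ (Fin l))) (hUopen : IsOpen U) (hUconn : IsConnected U)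
    (ξ : EuclideanSpace ℝ (Fin l) → Lp (EuclideanSpace ℝ (Fin d)) 1 P)
    (hξanal : AnalyticOnNhd ℝ ξ U) :
    ∃ M : EuclideanSpace ℝ (Fin l) → ℝ≥0 → Ω → EuclideanSpace ℝ (Fin d),
      -- (i) `M x` is a version of the martingale `t ↦ E_P[ξ x | F t]`
      (∀ x ∈ U, ∀ t : ℝ≥0,
        M x t =ᵐ[P] P[(ξ x : Ω → EuclideanSpace ℝ (Fin d)) | F t]) ∧
      -- (ii) every path is right-continuous, has left limits, and is bounded on `[0, ∞)`
      (∀ x ∈ U, ∀ ω : Ω,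
        (∀ t : ℝ≥0, ContinuousWithinAt (fun s => M x s ω) (Ici t) t) ∧
        (∀ t : ℝ≥0, 0 < t →
          ∃ L : EuclideanSpace ℝ (Fin d), Tendsto (fun s => M x s ω) (nhdsWithin t (Iio t)) (nhds L)) ∧
        BddAbove (range fun t : ℝ≥0 => ‖M x t ω‖)) ∧
      -- (iii) for every `ω`, the map `x ↦ (t ↦ M_t(x)(ω))` into the Banach space of bounded
      -- `ℝ^d`-valued functions on `[0, ∞)` with the sup norm is analytic on `U`
      (∃ Mb : EuclideanSpace ℝ (Fin l) → Ω →
          lp (fun _ : ℝ≥0 => EuclideanSpace ℝ (Fin d)) ∞,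
        (∀ x ∈ U, ∀ ω : Ω, ∀ t : ℝ≥0, (Mb x ω : ∀ _ : ℝ≥0, EuclideanSpace ℝ (Fin d)) t = M x t ω) ∧
        ∀ ω : Ω, AnalyticOnNhd ℝ (fun x => Mb x ω) U) := by
  classical
  choose! R hR Mb hMa hMc hMe using fun (y : EuclideanSpace ℝ (Fin l)) (hy : y ∈ U) =>
    exists_local F hright hcomplete ξ y (hξanal y hy)
  obtain ⟨T, hTU, hTc, hTcov⟩ := TopologicalSpace.countable_cover_nhdsWithin
    (f := fun y => Metric.ball y (R y)) (s := U)
    fun y hy => mem_nhdsWithin_of_mem_nhds (Metric.ball_mem_nhds y (hR y hy))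
  obtain ⟨Q, hQc, hQd⟩ := TopologicalSpace.exists_countable_dense (EuclideanSpace ℝ (Fin l))
  set G : Set Ω := {ω | ∀ i ∈ T, ∀ j ∈ T, ∀ x ∈ Q, ∀ s ∈ dyAll,
    x ∈ Metric.ball i (R i) → x ∈ Metric.ball j (R j) → Mb i x ω s = Mb j x ω s} with hG
  have hGae : ∀ᵐ ω ∂P, ω ∈ G := by
    refine (ae_ball_iff hTc).2 fun i hi => (ae_ball_iff hTc).2 fun j hj =>
      (ae_ball_iff hQc).2 fun x _ => (ae_ball_iff dyAll_countable).2 fun s _ => ?_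
    by_cases h1 : x ∈ Metric.ball i (R i)
    · by_cases h2 : x ∈ Metric.ball j (R j)
      · filter_upwards [hMe i (hTU hi) x h1 s, hMe j (hTU hj) x h2 s] with ω e1 e2 _ _
        exact e1.trans e2.symm
      · exact Eventually.of_forall fun ω _ h => absurd h h2
    · exact Eventually.of_forall fun ω h => absurd h h1
  have hGeq : ∀ ω ∈ G, ∀ i ∈ T, ∀ j ∈ T, ∀ x ∈ Metric.ball i (R i) ∩ Metric.ball j (R j),
      Mb i x ω = Mb j x ω := by
    intro ω hω i hi j hj x hx
    have hO : IsOpen (Metric.ball i (R i) ∩ Metric.ball j (R j)) :=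
      Metric.isOpen_ball.inter Metric.isOpen_ball
    have hQ : ∀ z ∈ (Metric.ball i (R i) ∩ Metric.ball j (R j)) ∩ Q, Mb i z ω = Mb j z ω :=
      fun z hz => cad_ext (hMc i (hTU hi) z ω) (hMc j (hTU hj) z ω)
        fun s hs => hω i hi j hj z hz.2 s hs hz.1.1 hz.1.2
    have hcl : x ∈ closure ((Metric.ball i (R i) ∩ Metric.ball j (R j)) ∩ Q) :=
      hQd.open_subset_closure_inter hO hx
    have := mem_closure_iff_nhdsWithin_neBot.1 hcl
    have c1 := ((hMa i (hTU hi) ω x hx.1).continuousAt.tendsto).mono_left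
      (nhdsWithin_le_nhds (s := (Metric.ball i (R i) ∩ Metric.ball j (R j)) ∩ Q))
    have c2 := ((hMa j (hTU hj) ω x hx.2).continuousAt.tendsto).mono_left
      (nhdsWithin_le_nhds (s := (Metric.ball i (R i) ∩ Metric.ball j (R j)) ∩ Q))
    refine tendsto_nhds_unique c1 (c2.congr' ?_)
    filter_upwards [self_mem_nhdsWithin] with z hz
    exact (hQ z hz).symm
  have hcov : ∀ x ∈ U, ∃ i ∈ T, x ∈ Metric.ball i (R i) := fun x hx => by
    simpa using hTcov hx
  choose! c hcT hcb using hcov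
  set N : EuclideanSpace ℝ (Fin l) → Ω → BPath d := fun x ω =>
    if ω ∈ G then Mb (c x) x ω else 0 with hN
  have hNc : ∀ x ∈ U, ∀ ω, N x ω ∈ cad d := by
    intro x hx ω
    by_cases hω : ω ∈ G
    · simp only [hN, hω, if_true]
      exact hMc _ (hTU (hcT x hx)) _ _
    · simp only [hN, hω, if_false]
      exact zero_mem _
  refine ⟨fun x t ω => N x ω t, ?_, ?_, N, fun _ _ _ _ => rfl, ?_⟩
  · intro x hx t
    filter_upwards [hMe _ (hTU (hcT x hx)) x (hcb x hx) t, hGae] with ω h1 h2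
    simp only [hN, h2, if_true]
    exact h1
  · intro x hx ω
    refine ⟨fun t => cad_rightCont (hNc x hx ω) t, fun t _ => (hNc x hx ω t).2, ‖N x ω‖, ?_⟩
    rintro _ ⟨t, rfl⟩
    exact lp.norm_apply_le_norm ENNReal.top_ne_zero (N x ω) t
  · intro ω x hx
    by_cases hω : ω ∈ G
    · refine (hMa _ (hTU (hcT x hx)) ω x (hcb x hx)).congr ?_
      filter_upwards [hUopen.mem_nhds hx, Metric.isOpen_ball.mem_nhds (hcb x hx)] with z hz1 hz2
      simp only [hN, hω, if_true]
      exact hGeq ω hω _ (hcT x hx) _ (hcT z hz1) z ⟨hz2, hcb z hz1⟩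
    · simp only [hN, hω, if_false]
      exact analyticAt_const
end
end

section
/- Let l, d ≥ 1 and let (ζ_α)_{α ∈ ℤ₊^l} be ℝ^d-valued integrable random variables with Σ_α 2^{|α|} E_P[|ζ_α|] < ∞, where |α| = α₁ + … + α_l. Let M^α be a right-continuous version of the uniformly integrable martingale M^α_t = E_P[ζ_α | F_t]. Then there exists a nondecreasing sequence (τ_m)_{m≥1} of stopping times with values in [0,∞] such that the sets {τ_m = ∞} increase to Ω as m → ∞ and, for each m ≥ 1, Σ_α E_P[ sup_{t≥0} |M^α_{t∧τ_m}| ] < ∞. -/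
open MeasureTheory Filter Set
open scoped ENNReal NNReal

noncomputable section

/-- A stopping time with values in `[0, ∞]` relative to the filtration `F`. -/
def IsStoppingTimeENN {Ω : Type*} {m : MeasurableSpace Ω}
    (F : Filtration ℝ≥0 m) (τ : Ω → ℝ≥0∞) : Prop :=
  ∀ t : ℝ≥0, MeasurableSet[F t] {ω | τ ω ≤ (t : ℝ≥0∞)}

/-- The process `M` stopped at the `[0, ∞]`-valued random time `τ`,
i.e. `t ↦ M_{t ∧ τ}`. -/
def stoppedAtENN {Ω E : Type*} (M : ℝ≥0 → Ω → E) (τ : Ω → ℝ≥0∞) : ℝ≥0 → Ω → E :=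
  fun t ω => if τ ω ≤ (t : ℝ≥0∞) then M (τ ω).toNNReal ω else M t ω

lemma aux_set {Ω : Type*} {m : MeasurableSpace Ω} {P : Measure Ω} [IsProbabilityMeasure P]
    {d : ℕ} (G : MeasurableSpace Ω) (hG : G ≤ m)
    (ζ : Ω → EuclideanSpace ℝ (Fin d)) (hζ : Integrable ζ P)
    (X : Ω → EuclideanSpace ℝ (Fin d)) (hX : X =ᵐ[P] P[ζ | G])
    (A : Set Ω) (hA : MeasurableSet[G] A) :
    ∫⁻ ω, A.indicator (fun ω => (‖X ω‖₊ : ℝ≥0∞)) ω ∂P ≤ ∫⁻ ω in A, ‖ζ ω‖₊ ∂P := by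
  have h1 := eLpNorm_condExp_le_eLpNorm (m := G) (μ := P) (A.indicator ζ) (le_refl 1)
  rw [eLpNorm_one_eq_lintegral_enorm, eLpNorm_one_eq_lintegral_enorm] at h1
  have h2 := condExp_indicator (m := G) hζ hA
  rw [← lintegral_indicator (hG A hA)]
  have e1 : ∫⁻ ω, A.indicator (fun ω => (‖X ω‖₊ : ℝ≥0∞)) ω ∂P
      = ∫⁻ ω, ‖(P[A.indicator ζ | G]) ω‖ₑ ∂P := by
    apply lintegral_congr_ae
    filter_upwards [hX, h2] with ω a b
    rw [b]
    by_cases h : ω ∈ A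
    · simp [h, a, enorm_eq_nnnorm]
    · simp [h]
  have e2 : ∫⁻ ω, A.indicator (fun ω => (‖ζ ω‖₊ : ℝ≥0∞)) ω ∂P
      = ∫⁻ ω, ‖A.indicator ζ ω‖ₑ ∂P := by
    apply lintegral_congr
    intro ω
    by_cases h : ω ∈ A
    · simp [h, enorm_eq_nnnorm]
    · simp [h]
  rw [e1, e2]; exact h1

lemma aux_stop {Ω : Type*} {m : MeasurableSpace Ω}
    (F : Filtration ℝ≥0 m)
    (hright : ∀ t : ℝ≥0, (F t : MeasurableSpace Ω) = ⨅ (s : ℝ≥0) (_ : t < s), F s)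
    (τ : Ω → ℝ≥0∞) (hτ : ∀ t : ℝ≥0, MeasurableSet[F t] {ω | τ ω < t}) :
    IsStoppingTimeENN F τ := by
  intro t
  rw [hright t]
  simp only [MeasurableSpace.measurableSet_iInf]
  intro s hts
  have hp : 0 < s - t := tsub_pos_of_lt hts
  have : {ω | τ ω ≤ (t : ℝ≥0∞)} = ⋂ n : ℕ, {ω | τ ω < ((t + (s - t) / (n + 1) : ℝ≥0) : ℝ≥0∞)} := by
    ext ω
    simp only [mem_setOf_eq, mem_iInter]
    constructor
    · intro h n
      refine h.trans_lt ?_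
      rw [ENNReal.coe_lt_coe]
      have : 0 < (s - t) / (n + 1) := by positivity
      exact lt_add_of_pos_right _ this
    · intro h
      have h3 : Tendsto (fun n : ℕ => t + (s - t) / ((n : ℝ≥0) + 1)) atTop (nhds (t + 0)) := by
        refine tendsto_const_nhds.add ?_
        have := (tendsto_one_div_add_atTop_nhds_zero_nat (𝕜 := ℝ≥0)).const_mul (s - t)
        simpa [div_eq_mul_inv] using this
      rw [add_zero] at h3
      exact ge_of_tendsto' (ENNReal.tendsto_coe.2 h3) fun n => (h n).le
  rw [this]
  refine MeasurableSet.iInter fun n => ?_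
  refine F.mono ?_ _ (hτ _)
  have : (s - t) / ((n : ℝ≥0) + 1) ≤ s - t := div_le_self (by positivity) (by simp)
  calc t + (s - t) / ((n : ℝ≥0) + 1) ≤ t + (s - t) := by gcongr
    _ = s := add_tsub_cancel_of_le hts.le

lemma aux_opt {Ω : Type*} {m : MeasurableSpace Ω} {P : Measure Ω} [IsProbabilityMeasure P]
    (F : Filtration ℝ≥0 m) {d : ℕ}
    (ζ : Ω → EuclideanSpace ℝ (Fin d)) (hζ : Integrable ζ P)
    (M : ℝ≥0 → Ω → EuclideanSpace ℝ (Fin d))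
    (hM : ∀ t : ℝ≥0, M t =ᵐ[P] P[ζ | F t])
    (hrc : ∀ ω, ∀ t : ℝ≥0, ContinuousWithinAt (fun s => M s ω) (Ici t) t)
    (τ : Ω → ℝ≥0∞) (hτ : ∀ t : ℝ≥0, MeasurableSet[F t] {ω | τ ω < t}) :
    ∫⁻ ω, {ω | τ ω < ∞}.indicator (fun ω => (‖M (τ ω).toNNReal ω‖₊ : ℝ≥0∞)) ω ∂P
      ≤ ∫⁻ ω, ‖ζ ω‖₊ ∂P := by
  classical
  let A : ℕ → ℕ → Set Ω := fun k j => {ω | τ ω < ∞ ∧ ⌊((k : ℝ≥0) + 1) * (τ ω).toNNReal⌋₊ = j}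
  let r : ℕ → ℕ → ℝ≥0 := fun k j => ((j : ℝ≥0) + 1) / ((k : ℝ≥0) + 1)
  have hA : ∀ k j, MeasurableSet[F (r k j)] (A k j) := by
    intro k j
    have : A k j = {ω | τ ω < (r k j : ℝ≥0)} \ {ω | τ ω < ((j / (k + 1) : ℝ≥0) : ℝ≥0∞)} := by
      ext ω
      simp only [A, r, mem_setOf_eq, mem_diff]
      rcases eq_or_ne (τ ω) ∞ with h | h
      · simp [h]
      · lift τ ω to ℝ≥0 using h with s
        have hk : (0 : ℝ≥0) < (k : ℝ≥0) + 1 := by positivity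
        simp only [ENNReal.coe_lt_top, true_and, ENNReal.toNNReal_coe, ENNReal.coe_lt_coe, not_lt]
        rw [Nat.floor_eq_iff (by positivity), lt_div_iff₀ hk, div_le_iff₀ hk, mul_comm]
        tauto
    rw [this]
    refine (hτ _).diff (F.mono ?_ _ (hτ _))
    simp only [r]
    gcongr
    simp
  let g : ℕ → Ω → ℝ≥0∞ := fun k ω =>
    ∑' j, (A k j).indicator (fun ω => (‖M (r k j) ω‖₊ : ℝ≥0∞)) ω
  have hmeas1 : ∀ k j, AEMeasurable ((A k j).indicator (fun ω => (‖M (r k j) ω‖₊ : ℝ≥0∞))) P := by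
    intro k j
    refine AEMeasurable.indicator ?_ (F.le _ _ (hA k j))
    have : AEStronglyMeasurable (M (r k j)) P :=
      (integrable_condExp.aestronglyMeasurable).congr (hM (r k j)).symm
    exact this.enorm
  have hgm : ∀ k, AEMeasurable (g k) P := fun k => AEMeasurable.ennreal_tsum (hmeas1 k)
  have hgi : ∀ k, ∫⁻ ω, g k ω ∂P ≤ ∫⁻ ω, ‖ζ ω‖₊ ∂P := by
    intro k
    rw [lintegral_tsum (hmeas1 k)]
    calc _ ≤ ∑' j, ∫⁻ ω in A k j, ‖ζ ω‖₊ ∂P :=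
          ENNReal.tsum_le_tsum fun j => aux_set (F (r k j)) (F.le _) ζ hζ _ (hM _) _ (hA k j)
      _ = ∫⁻ ω in ⋃ j, A k j, ‖ζ ω‖₊ ∂P := by
          rw [lintegral_iUnion (fun j => F.le _ _ (hA k j))]
          intro i j hij
          refine Set.disjoint_left.2 fun ω h1 h2 => hij ?_
          exact h1.2.symm.trans h2.2
      _ ≤ _ := setLIntegral_le_lintegral _ _
  have hpt : ∀ ω, {ω | τ ω < ∞}.indicator (fun ω => (‖M (τ ω).toNNReal ω‖₊ : ℝ≥0∞)) ω
      ≤ liminf (fun k => g k ω) atTop := by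
    intro ω
    by_cases h : τ ω < ∞
    swap
    · simp [h]
    rw [indicator_of_mem (by exact h)]
    set s := (τ ω).toNNReal with hs
    let R : ℕ → ℝ≥0 := fun k => r k ⌊((k : ℝ≥0) + 1) * s⌋₊
    have hg : ∀ k, g k ω = ‖M (R k) ω‖₊ := by
      intro k
      simp only [g]
      rw [tsum_eq_single ⌊((k : ℝ≥0) + 1) * s⌋₊]
      · rw [indicator_of_mem]
        exact ⟨h, rfl⟩
      · intro j hj
        rw [indicator_of_notMem]
        intro hh
        exact hj hh.2.symm
    have hR1 : ∀ k, s ≤ R k := by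
      intro k
      have hk : (0 : ℝ≥0) < (k : ℝ≥0) + 1 := by positivity
      simp only [R, r]
      rw [le_div_iff₀ hk, mul_comm]
      exact (Nat.lt_floor_add_one _).le
    have hR2 : ∀ k : ℕ, R k ≤ s + 1 / ((k : ℝ≥0) + 1) := by
      intro k
      have hk : (0 : ℝ≥0) < (k : ℝ≥0) + 1 := by positivity
      simp only [R, r]
      rw [add_div]
      gcongr
      rw [div_le_iff₀ hk, mul_comm]
      exact Nat.floor_le (by positivity)
    have hR : Tendsto R atTop (nhds s) := by
      refine tendsto_of_tendsto_of_tendsto_of_le_of_le tendsto_const_nhds ?_ hR1 hR2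
      simpa using (tendsto_const_nhds (x := s)).add
        (tendsto_one_div_add_atTop_nhds_zero_nat (𝕜 := ℝ≥0))
    have hR' : Tendsto R atTop (nhdsWithin s (Ici s)) :=
      tendsto_nhdsWithin_iff.2 ⟨hR, Eventually.of_forall hR1⟩
    have ht : Tendsto (fun k => g k ω) atTop (nhds (‖M s ω‖₊ : ℝ≥0∞)) := by
      simp only [hg]
      exact ENNReal.tendsto_coe.2 ((hrc ω s).tendsto.comp hR').nnnorm
    exact ht.liminf_eq.ge
  calc _ ≤ ∫⁻ ω, liminf (fun k => g k ω) atTop ∂P := lintegral_mono hpt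
    _ ≤ liminf (fun k => ∫⁻ ω, g k ω ∂P) atTop := lintegral_liminf_le' hgm
    _ ≤ liminf (fun _ : ℕ => ∫⁻ ω, ‖ζ ω‖₊ ∂P) atTop :=
        liminf_le_liminf (Eventually.of_forall hgi)
    _ = _ := by simp

lemma aux_geom (l : ℕ) : ∑' α : Fin l → ℕ, ((2 : ℝ≥0∞)⁻¹) ^ (∑ i, α i) ≠ ∞ := by
  induction l with
  | zero => simp [tsum_fintype]
  | succ l ih =>
    rw [← (Fin.consEquiv (fun _ : Fin (l + 1) => ℕ)).tsum_eq, ENNReal.tsum_prod']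
    simp only [Fin.consEquiv, Equiv.coe_fn_mk, Fin.sum_univ_succ, Fin.cons_zero, Fin.cons_succ,
      pow_add, ENNReal.tsum_mul_left, ENNReal.tsum_mul_right]
    refine ENNReal.mul_ne_top ?_ ih
    rw [ENNReal.tsum_geometric]
    simp

lemma aux_measlt {Ω : Type*} {m : MeasurableSpace Ω} (F : Filtration ℝ≥0 m)
    (τ : Ω → ℝ≥0∞) (hτ : ∀ t : ℝ≥0, MeasurableSet[F t] {ω | τ ω < t}) :
    MeasurableSet {ω | τ ω < ∞} := by
  have : {ω | τ ω < ∞} = ⋃ k : ℕ, {ω | τ ω < ((k : ℝ≥0) : ℝ≥0∞)} := by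
    ext ω
    simp only [mem_setOf_eq, mem_iUnion]
    constructor
    · intro h
      obtain ⟨k, hk⟩ := ENNReal.exists_nat_gt h.ne
      exact ⟨k, by simpa using hk⟩
    · rintro ⟨k, hk⟩
      exact hk.trans ENNReal.coe_lt_top
  rw [this]
  exact MeasurableSet.iUnion fun k => F.le _ _ (hτ _)

/-- Hitting time of the exterior of a ball, computed along rational times, off a null set. -/
def hitTime {Ω : Type*} {d : ℕ} (N : Set Ω) (M : ℝ≥0 → Ω → EuclideanSpace ℝ (Fin d)) (c : ℝ≥0)
    (ω : Ω) : ℝ≥0∞ :=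
  ⨅ q : ℚ≥0, ⨅ _ : ω ∉ N ∧ c < ‖M (q : ℝ≥0) ω‖₊, (((q : ℝ≥0)) : ℝ≥0∞)

lemma hitTime_lt {Ω : Type*} {d : ℕ} (N : Set Ω) (M : ℝ≥0 → Ω → EuclideanSpace ℝ (Fin d))
    (c : ℝ≥0) (ω : Ω) (t : ℝ≥0∞) : hitTime N M c ω < t ↔
      ∃ q : ℚ≥0, (ω ∉ N ∧ c < ‖M (q : ℝ≥0) ω‖₊) ∧ (((q : ℝ≥0)) : ℝ≥0∞) < t := by
  simp only [hitTime, iInf_lt_iff, exists_prop]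

lemma hitTime_meas {Ω : Type*} {m : MeasurableSpace Ω} {P : Measure Ω}
    (F : Filtration ℝ≥0 m) {d : ℕ} (N : Set Ω) (hN : MeasurableSet[F 0] N)
    (ζ : Ω → EuclideanSpace ℝ (Fin d))
    (M : ℝ≥0 → Ω → EuclideanSpace ℝ (Fin d)) (c : ℝ≥0)
    (hM : ∀ ω ∉ N, ∀ q : ℚ≥0, M (q : ℝ≥0) ω = (P[ζ | F (q : ℝ≥0)]) ω) (t : ℝ≥0) :
    MeasurableSet[F t] {ω | hitTime N M c ω < t} := by
  have : {ω | hitTime N M c ω < t} = ⋃ q : ℚ≥0, ⋃ _ : (q : ℝ≥0) < t,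
      (Nᶜ ∩ {ω | c < ‖(P[ζ | F (q : ℝ≥0)]) ω‖₊}) := by
    ext ω
    simp only [mem_setOf_eq, hitTime_lt, mem_iUnion, mem_inter_iff, mem_compl_iff,
      ENNReal.coe_lt_coe, exists_prop]
    refine exists_congr fun q => ?_
    constructor
    · rintro ⟨⟨a, b⟩, e⟩
      rw [hM ω a q] at b
      exact ⟨e, a, b⟩
    · rintro ⟨e, a, b⟩
      rw [← hM ω a q] at b
      exact ⟨⟨a, b⟩, e⟩
  rw [this]
  refine MeasurableSet.iUnion fun q => MeasurableSet.iUnion fun hq => ?_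
  refine MeasurableSet.inter (F.mono (zero_le (a := t)) _ hN).compl ?_
  refine F.mono hq.le _ ?_
  exact measurableSet_lt measurable_const
    (stronglyMeasurable_condExp (m := F (q : ℝ≥0)) (μ := P) (f := ζ)).nnnorm.measurable

lemma exists_rat_right {d : ℕ} (f : ℝ≥0 → EuclideanSpace ℝ (Fin d)) (s : ℝ≥0)
    (hf : ContinuousWithinAt f (Ici s) s) (c : ℝ≥0) (h : c < ‖f s‖₊) (b : ℝ≥0∞) (hb : s < b) :
    ∃ q : ℚ≥0, c < ‖f (q : ℝ≥0)‖₊ ∧ ((q : ℝ≥0) : ℝ≥0∞) < b := by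
  have h1 : ∀ᶠ x in nhdsWithin s (Ici s), c < ‖f x‖₊ := hf.nnnorm.eventually (lt_mem_nhds h)
  have h1' : ∀ᶠ x in nhdsWithin s (Ioi s), c < ‖f x‖₊ := nhdsWithin_mono _ Ioi_subset_Ici_self h1
  obtain ⟨u, hu, hsub⟩ := (mem_nhdsGT_iff_exists_Ioo_subset).1 h1'
  have hlt : s < min (u : ℝ≥0∞) b := lt_min (by simpa using hu) hb
  obtain ⟨v, hv1, hv2⟩ := ENNReal.lt_iff_exists_nnreal_btwn.1 hlt
  rw [ENNReal.coe_lt_coe] at hv1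
  have hq : ∃ q : ℚ≥0, s < (q : ℝ≥0) ∧ (q : ℝ≥0) < v := by
    obtain ⟨q, hq1, hq2⟩ := exists_rat_btwn (show (s : ℝ) < v from hv1)
    have hq0 : 0 ≤ q := by
      have : (0 : ℝ) < q := s.2.trans_lt hq1
      exact_mod_cast this.le
    lift q to ℚ≥0 using hq0
    have hc : (((q : ℝ≥0)) : ℝ) = ((q : ℚ) : ℝ) := by
      rw [NNRat.cast_def, NNRat.cast_def]
      push_cast
      rfl
    rw [← hc] at hq1 hq2
    exact ⟨q, NNReal.coe_lt_coe.1 hq1, NNReal.coe_lt_coe.1 hq2⟩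
  obtain ⟨q, hq1, hq2⟩ := hq
  have hv3 := lt_min_iff.1 hv2
  have hqv : ((q : ℝ≥0) : ℝ≥0∞) < v := ENNReal.coe_lt_coe.2 hq2
  exact ⟨q, hsub ⟨hq1, ENNReal.coe_lt_coe.1 (hqv.trans hv3.1)⟩, hqv.trans hv3.2⟩

lemma hitTime_below {Ω : Type*} {d : ℕ} (N : Set Ω) (M : ℝ≥0 → Ω → EuclideanSpace ℝ (Fin d))
    (c : ℝ≥0) (ω : Ω) (hω : ω ∉ N) (s : ℝ≥0)
    (hf : ContinuousWithinAt (fun s => M s ω) (Ici s) s)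
    (hs : (s : ℝ≥0∞) < hitTime N M c ω) : ‖M s ω‖₊ ≤ c := by
  by_contra! h
  obtain ⟨q, h1, h2⟩ := exists_rat_right (fun s => M s ω) s hf c h _ hs
  exact lt_irrefl _ ((hitTime_lt N M c ω _).2 ⟨q, ⟨hω, h1⟩, h2⟩)

lemma hitTime_at {Ω : Type*} {d : ℕ} (N : Set Ω) (M : ℝ≥0 → Ω → EuclideanSpace ℝ (Fin d))
    (c : ℝ≥0) (ω : Ω)
    (hf : ∀ s, ContinuousWithinAt (fun s => M s ω) (Ici s) s)
    (hs : hitTime N M c ω < ∞) : c ≤ ‖M (hitTime N M c ω).toNNReal ω‖₊ := by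
  set s := (hitTime N M c ω).toNNReal with hsdef
  have hse : hitTime N M c ω = s := (ENNReal.coe_toNNReal hs.ne).symm
  by_contra! h
  have h1 : ∀ᶠ x in nhdsWithin s (Ici s), ‖M x ω‖₊ < c :=
    (hf s).nnnorm.eventually (gt_mem_nhds h)
  obtain ⟨u, hu, hsub⟩ := (mem_nhdsGE_iff_exists_Ico_subset).1 h1
  have h2 : hitTime N M c ω < u := by rw [hse]; exact_mod_cast hu
  obtain ⟨q, ⟨hq1, hq2⟩, hq3⟩ := (hitTime_lt N M c ω _).1 h2
  have hq4 : hitTime N M c ω ≤ (q : ℝ≥0) := iInf₂_le q ⟨hq1, hq2⟩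
  rw [hse, ENNReal.coe_le_coe] at hq4
  have : ‖M (q : ℝ≥0) ω‖₊ < c := hsub ⟨hq4, by exact_mod_cast hq3⟩
  exact lt_asymm this hq2

theorem localization_of_summable_martingale_family
    {Ω : Type*} {m : MeasurableSpace Ω} {P : Measure Ω} [IsProbabilityMeasure P]
    (F : Filtration ℝ≥0 m)
    -- usual conditions
    (hright : ∀ t : ℝ≥0, (F t : MeasurableSpace Ω) = ⨅ (s : ℝ≥0) (_ : t < s), F s)
    (hcomplete : ∀ s : Set Ω, MeasurableSet[m] s → P s = 0 → MeasurableSet[F 0] s)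
    {l d : ℕ} (hl : 1 ≤ l) (hd : 1 ≤ d)
    -- the terminal values `ζ_α`, `α ∈ ℤ₊^l`, with `Σ_α 2^{|α|} E_P[|ζ_α|] < ∞`
    (ζ : (Fin l → ℕ) → Ω → EuclideanSpace ℝ (Fin d))
    (hζint : ∀ α, Integrable (ζ α) P)
    (hsum : ∑' α : Fin l → ℕ, (2 : ℝ≥0∞) ^ (∑ i, α i) * ∫⁻ ω, ‖ζ α ω‖₊ ∂P ≠ ∞)
    -- `M α` is a right-continuous version of the martingale `t ↦ E_P[ζ_α | F t]`
    (M : (Fin l → ℕ) → ℝ≥0 → Ω → EuclideanSpace ℝ (Fin d))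
    (hMver : ∀ α, ∀ t : ℝ≥0, M α t =ᵐ[P] P[ζ α | F t])
    (hMrc : ∀ α, ∀ ω, ∀ t : ℝ≥0, ContinuousWithinAt (fun s => M α s ω) (Ici t) t) :
    ∃ τ : ℕ → Ω → ℝ≥0∞,
      (∀ n, IsStoppingTimeENN F (τ n)) ∧
      (∀ ω, Monotone fun n => τ n ω) ∧
      -- the sets `{τ_m = ∞}` increase to `Ω`
      (∀ ω, ∃ n, τ n ω = ∞) ∧
      -- `Σ_α E_P[ sup_t |M^α_{t ∧ τ_m}| ] < ∞` for every `m`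
      ∀ n, ∑' α : Fin l → ℕ,
        ∫⁻ ω, ⨆ t : ℝ≥0, (‖stoppedAtENN (M α) (τ n) t ω‖₊ : ℝ≥0∞) ∂P ≠ ∞ := by
  classical
  -- the exceptional null set
  have hae : ∀ᵐ ω ∂P, ∀ α, ∀ q : ℚ≥0, M α (q : ℝ≥0) ω = (P[ζ α | F (q : ℝ≥0)]) ω := by
    rw [ae_all_iff]; intro α
    rw [ae_all_iff]; intro q
    exact hMver α q
  set N : Set Ω := toMeasurable P
    {ω | ∀ α, ∀ q : ℚ≥0, M α (q : ℝ≥0) ω = (P[ζ α | F (q : ℝ≥0)]) ω}ᶜ with hNdef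
  have hN0 : P N = 0 := by rw [hNdef, measure_toMeasurable]; exact hae
  have hNF : MeasurableSet[F 0] N := hcomplete N (measurableSet_toMeasurable _ _) hN0
  have hNM : ∀ ω ∉ N, ∀ α, ∀ q : ℚ≥0, M α (q : ℝ≥0) ω = (P[ζ α | F (q : ℝ≥0)]) ω := by
    intro ω hω
    by_contra h
    exact hω (subset_toMeasurable P _ h)
  let c : ℕ → (Fin l → ℕ) → ℝ≥0 := fun n α => ((n : ℝ≥0) + 1) * (2⁻¹) ^ (∑ i, α i)
  have hcpos : ∀ n α, 0 < c n α := fun n α => by simp only [c]; positivity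
  let ρ : ℕ → (Fin l → ℕ) → Ω → ℝ≥0∞ := fun n α => hitTime N (M α) (c n α)
  have hρm : ∀ n α, ∀ t : ℝ≥0, MeasurableSet[F t] {ω | ρ n α ω < t} := fun n α t =>
    hitTime_meas (P := P) F N hNF (ζ α) (M α) (c n α) (fun ω hω q => hNM ω hω α q) t
  have hρP : ∀ n α, P {ω | ρ n α ω < ∞} ≤
      ((n : ℝ≥0∞) + 1)⁻¹ * ((2 : ℝ≥0∞) ^ (∑ i, α i) * ∫⁻ ω, ‖ζ α ω‖₊ ∂P) := by
    intro n α
    have h1 := aux_opt F (ζ α) (hζint α) (M α) (hMver α) (hMrc α) (ρ n α) (hρm n α)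
    have h2 : (c n α : ℝ≥0∞) * P {ω | ρ n α ω < ∞} ≤ ∫⁻ ω, ‖ζ α ω‖₊ ∂P := by
      refine le_trans ?_ h1
      rw [← lintegral_indicator_const (aux_measlt F _ (hρm n α))]
      refine lintegral_mono fun ω => ?_
      refine Set.indicator_le_indicator' ?_
      intro hω
      exact ENNReal.coe_le_coe.2 (hitTime_at N (M α) (c n α) ω (hMrc α ω) hω)
    have h3 : (c n α : ℝ≥0∞) ≠ 0 := by exact_mod_cast (hcpos n α).ne'
    have h4 : P {ω | ρ n α ω < ∞} ≤ (c n α : ℝ≥0∞)⁻¹ * ∫⁻ ω, ‖ζ α ω‖₊ ∂P := by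
      rw [mul_comm, ← div_eq_mul_inv, ENNReal.le_div_iff_mul_le (Or.inl h3)
        (Or.inl ENNReal.coe_ne_top), mul_comm]
      exact h2
    refine h4.trans (le_of_eq ?_)
    rw [← mul_assoc]
    congr 1
    have : (c n α : ℝ≥0∞) = ((n : ℝ≥0∞) + 1) * (2⁻¹) ^ (∑ i, α i) := by
      simp [c, ENNReal.inv_pow]
    rw [this, ENNReal.mul_inv (Or.inl (by simp)) (Or.inl (by simp)), ← ENNReal.inv_pow, inv_inv]
  let σ : ℕ → Ω → ℝ≥0∞ := fun n ω => ⨅ α, ρ n α ω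
  have hσlt : ∀ n (t : ℝ≥0∞), {ω | σ n ω < t} = ⋃ α, {ω | ρ n α ω < t} := by
    intro n t; ext ω; simp [σ, iInf_lt_iff]
  have hσm : ∀ n, ∀ t : ℝ≥0, MeasurableSet[F t] {ω | σ n ω < t} := by
    intro n t
    rw [hσlt]
    exact MeasurableSet.iUnion fun α => hρm n α t
  have hσmono : ∀ ω, Monotone fun n => σ n ω := by
    intro ω n k hnk
    refine iInf_mono fun α => ?_
    refine le_of_forall_gt fun t ht => ?_
    obtain ⟨q, ⟨h1, h2⟩, h3⟩ := (hitTime_lt _ _ _ _ _).1 ht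
    refine (hitTime_lt _ _ _ _ _).2 ⟨q, ⟨h1, lt_of_le_of_lt ?_ h2⟩, h3⟩
    simp only [c]
    gcongr
  set S := ∑' α : Fin l → ℕ, (2 : ℝ≥0∞) ^ (∑ i, α i) * ∫⁻ ω, ‖ζ α ω‖₊ ∂P with hS
  have hσP : ∀ n, P {ω | σ n ω < ∞} ≤ ((n : ℝ≥0∞) + 1)⁻¹ * S := by
    intro n
    rw [hσlt, hS, ← ENNReal.tsum_mul_left]
    exact (measure_iUnion_le _).trans (ENNReal.tsum_le_tsum fun α => hρP n α)
  let N1 : Set Ω := ⋂ n, {ω | σ n ω < ∞}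
  have hN1P : P N1 = 0 := by
    have hle : ∀ n : ℕ, P N1 ≤ ((n : ℝ≥0∞) + 1)⁻¹ * S := fun n =>
      (measure_mono (iInter_subset _ n)).trans (hσP n)
    have ht : Tendsto (fun n : ℕ => ((n : ℝ≥0∞) + 1)⁻¹ * S) atTop (nhds (0 * S)) := by
      refine ENNReal.Tendsto.mul_const ?_ (Or.inr hsum)
      have := (tendsto_add_atTop_iff_nat 1).2 ENNReal.tendsto_inv_nat_nhds_zero
      simpa using this
    rw [zero_mul] at ht
    exact le_antisymm (ge_of_tendsto' ht hle) zero_le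
  have hN1F : MeasurableSet[F 0] N1 :=
    hcomplete _ (MeasurableSet.iInter fun n => aux_measlt F _ (hσm n)) hN1P
  let τ : ℕ → Ω → ℝ≥0∞ := fun n ω => if ω ∈ N1 then ∞ else σ n ω
  have hτm : ∀ n, ∀ t : ℝ≥0, MeasurableSet[F t] {ω | τ n ω < t} := by
    intro n t
    have : {ω | τ n ω < t} = {ω | σ n ω < t} \ N1 := by
      ext ω
      by_cases h : ω ∈ N1 <;> simp [τ, h]
    rw [this]
    exact (hσm n t).diff (F.mono (zero_le (a := t)) _ hN1F)
  refine ⟨τ, fun n => aux_stop F hright _ (hτm n), ?_, ?_, ?_⟩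
  · intro ω n k hnk
    by_cases h : ω ∈ N1
    · simp [τ, h]
    · simpa [τ, h] using hσmono ω hnk
  · intro ω
    by_cases h : ω ∈ N1
    · exact ⟨0, by simp [τ, h]⟩
    · have h' := h
      simp only [N1, mem_iInter, mem_setOf_eq, not_forall, not_lt, top_le_iff] at h'
      obtain ⟨n, hn⟩ := h'
      exact ⟨n, by simp [τ, h, hn]⟩
  · intro n
    have hbound : ∀ α, ∫⁻ ω, ⨆ t : ℝ≥0, (‖stoppedAtENN (M α) (τ n) t ω‖₊ : ℝ≥0∞) ∂P
        ≤ ((n : ℝ≥0∞) + 1) * (2⁻¹) ^ (∑ i, α i)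
          + (2 : ℝ≥0∞) ^ (∑ i, α i) * ∫⁻ ω, ‖ζ α ω‖₊ ∂P := by
      intro α
      have hc : (c n α : ℝ≥0∞) = ((n : ℝ≥0∞) + 1) * (2⁻¹) ^ (∑ i, α i) := by
        simp [c, ENNReal.inv_pow]
      rw [← hc]
      have h1 := aux_opt F (ζ α) (hζint α) (M α) (hMver α) (hMrc α) (τ n) (hτm n)
      calc _ ≤ ∫⁻ ω, ((c n α : ℝ≥0∞) +
            {ω | τ n ω < ∞}.indicator (fun ω => (‖M α (τ n ω).toNNReal ω‖₊ : ℝ≥0∞)) ω) ∂P := by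
            refine lintegral_mono_ae ?_
            have e1 : ∀ᵐ ω ∂P, ω ∉ N := measure_eq_zero_iff_ae_notMem.1 hN0
            have e2 : ∀ᵐ ω ∂P, ω ∉ N1 := measure_eq_zero_iff_ae_notMem.1 hN1P
            filter_upwards [e1, e2] with ω w1 w2
            refine iSup_le fun t => ?_
            by_cases ht : τ n ω ≤ t
            · have hlt : τ n ω < ∞ := ht.trans_lt ENNReal.coe_lt_top
              rw [indicator_of_mem (by exact hlt)]
              simp only [stoppedAtENN, ht, if_true]
              exact le_add_self
            · simp only [stoppedAtENN, ht, if_false]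
              refine le_add_right ?_
              push Not at ht
              have ht' : (t : ℝ≥0∞) < ρ n α ω := by
                refine ht.trans_le ?_
                simp only [τ, w2, if_false]
                exact iInf_le _ α
              exact ENNReal.coe_le_coe.2
                (hitTime_below N (M α) (c n α) ω w1 t (hMrc α ω t) ht')
        _ = (c n α : ℝ≥0∞) + ∫⁻ ω,
            {ω | τ n ω < ∞}.indicator (fun ω => (‖M α (τ n ω).toNNReal ω‖₊ : ℝ≥0∞)) ω ∂P := by
            rw [lintegral_add_left measurable_const]
            simp
        _ ≤ _ := by
            gcongr
            refine h1.trans ?_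
            exact le_mul_of_one_le_left zero_le (one_le_pow₀ one_le_two)
    refine ne_top_of_le_ne_top ?_ (ENNReal.tsum_le_tsum hbound)
    rw [ENNReal.tsum_add, ENNReal.tsum_mul_left]
    refine ENNReal.add_ne_top.2 ⟨ENNReal.mul_ne_top (by simp) (aux_geom l), hsum⟩
end
end
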